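/- Let M be a finite dimensional indecomposable left H_{mn}(ξ)-module of (s,t)-type. Then: (1) s ≤ 2t and t ≤ 2s; (2) if s ≠ 1 then t < 2s; (3) if t ≠ 1 then s < 2t. -/

import Mathlib

noncomputable section

namespace Radford

variable (𝕜 : Type) [Field 𝕜]

/-- The q-integer `(k)_q = 1 + q + ⋯ + q^(k-1)`. -/
def qInt (q : 𝕜) (k : ℕ) : 𝕜 := ∑ j ∈ Finset.range k, q ^ j

/-- The q-factorial `(k)!_q = (1)_q (2)_q ⋯ (k)_q`. -/
def qFact (q : 𝕜) : ℕ → 𝕜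
  | 0 => 1
  | k + 1 => qFact q k * qInt 𝕜 q (k + 1)

variable (m n : ℕ) (ξ : 𝕜)

/-- Generators of the free algebra: 0 ↦ a, 1 ↦ b, 2 ↦ c, 3 ↦ d. -/
def fgen (k : Fin 4) : FreeAlgebra 𝕜 (Fin 4) := FreeAlgebra.ι 𝕜 k

local notation "fa" => fgen 𝕜 0
local notation "fb" => fgen 𝕜 1
local notation "fc" => fgen 𝕜 2
local notation "fd" => fgen 𝕜 3

/-- The defining relations of the Drinfeld double `H_{mn}(ξ) = D(R_{mn}(q))`, where `q = ξ^m`. -/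
inductive HRel : FreeAlgebra 𝕜 (Fin 4) → FreeAlgebra 𝕜 (Fin 4) → Prop
  | aPow : HRel (fa ^ n) (fb ^ n - 1)
  | bPow : HRel (fb ^ (m * n)) 1
  | cPow : HRel (fc ^ (m * n)) 1
  | dPow : HRel (fd ^ n) 0
  | ab : HRel (fa * fb) (ξ ^ m • (fb * fa))
  | dc : HRel (fd * fc) (ξ • (fc * fd))
  | bc : HRel (fb * fc) (fc * fb)
  | bd : HRel (fb * fd) (ξ ^ m • (fd * fb))
  | ad : HRel (fa * fd - fd * fa) (fb - fc ^ m)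
  | ac : HRel (fa * fc)
      (ξ⁻¹ • (fc * fa) +
        ((ξ⁻¹ - ξ ^ (n - 1)) / qFact 𝕜 (ξ ^ m) (n - 1)) •
          ((fc ^ (m + 1) - ξ ^ m • (fb * fc)) * fd ^ (n - 1)))

/-- The Drinfeld double `H_{mn}(ξ)` of the Radford Hopf algebra `R_{mn}(q)`, presented by
generators `a, b, c, d` and the above relations. -/
def H := RingQuot (HRel 𝕜 m n ξ)

instance : Ring (H 𝕜 m n ξ) := inferInstanceAs (Ring (RingQuot (HRel 𝕜 m n ξ)))

instance : Algebra 𝕜 (H 𝕜 m n ξ) := inferInstanceAs (Algebra 𝕜 (RingQuot (HRel 𝕜 m n ξ)))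

/-- The generators `a, b, c, d` of `H_{mn}(ξ)` (indexed by 0,1,2,3). -/
def gen (k : Fin 4) : H 𝕜 m n ξ := RingQuot.mkAlgHom 𝕜 (HRel 𝕜 m n ξ) (fgen 𝕜 k)

local notation "ha" => gen 𝕜 m n ξ 0
local notation "hb" => gen 𝕜 m n ξ 1
local notation "hc" => gen 𝕜 m n ξ 2
local notation "hd" => gen 𝕜 m n ξ 3

/-- The Jacobson radical `J` of `H_{mn}(ξ)`. -/
def jrad : Ideal (H 𝕜 m n ξ) := Ideal.jacobson ⊥

/-- The scalars `α_k(l,i)`;  `alph l i k` is `α_k(l,i)`, where `q = ξ^m`. -/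
def alph (l : ℕ) (i : ℤ) (k : ℕ) : 𝕜 :=
  if k = n then ((ξ ^ m) ^ (i + (l : ℤ)) - (ξ ^ m) ^ i) / qFact 𝕜 (ξ ^ m) (n - 1)
  else qInt 𝕜 (ξ ^ m) k * ((ξ ^ m) ^ i - (ξ ^ m) ^ (i + (l : ℤ) - (k : ℤ)))

/-- The scalars `γ_k(l,i)`;  `gam l i k` is `γ_k(l,i)`, where `q = ξ^m`. -/
def gam (l : ℕ) (i : ℤ) (k : ℕ) : 𝕜 :=
  if k = n then ((ξ ^ m) ^ i - (ξ ^ m) ^ (i + (l : ℤ))) / qFact 𝕜 (ξ ^ m) (n - 1)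
  else qInt 𝕜 (ξ ^ m) k * ((ξ ^ m) ^ (i + (l : ℤ)) - (ξ ^ m) ^ (i - (k : ℤ)))

section ModuleH

variable {W : Type} [AddCommGroup W] [Module (H 𝕜 m n ξ) W]

variable (W) in
/-- The socle of an `H`-module: the sum of all simple submodules. -/
def socle : Submodule (H 𝕜 m n ξ) W :=
  sSup {N : Submodule (H 𝕜 m n ξ) W | IsSimpleModule (H 𝕜 m n ξ) N}

variable (W) in
/-- The submodule `J•W`, the radical of `W`. -/
def radM : Submodule (H 𝕜 m n ξ) W :=
  Submodule.span (H 𝕜 m n ξ) {x | ∃ r ∈ jrad 𝕜 m n ξ, ∃ w : W, x = r • w}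

variable (W) in
/-- The submodule `J²•W`. -/
def rad2M : Submodule (H 𝕜 m n ξ) W :=
  Submodule.span (H 𝕜 m n ξ)
    {x | ∃ r ∈ jrad 𝕜 m n ξ, ∃ s ∈ jrad 𝕜 m n ξ, ∃ w : W, x = r • s • w}

variable (W) in
/-- The submodule `J³•W`. -/
def rad3M : Submodule (H 𝕜 m n ξ) W :=
  Submodule.span (H 𝕜 m n ξ)
    {x | ∃ r ∈ jrad 𝕜 m n ξ, ∃ s ∈ jrad 𝕜 m n ξ, ∃ t ∈ jrad 𝕜 m n ξ, ∃ w : W, x = r • s • t • w}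

variable (W) in
/-- `lengthIs c W` : the `H`-module `W` has a composition series of length `c`
(hence, by Jordan–Hölder, has composition length `c`). -/
def lengthIs (c : ℕ) : Prop :=
  ∃ s : CompositionSeries (Submodule (H 𝕜 m n ξ) W), s.head = ⊥ ∧ s.last = ⊤ ∧ s.length = c

variable (W) in
/-- An `H`-module is indecomposable if it is nonzero and is not the direct sum of two
nonzero submodules. -/
def Indec : Prop :=
  Nontrivial W ∧ ∀ N₁ N₂ : Submodule (H 𝕜 m n ξ) W, IsCompl N₁ N₂ → N₁ = ⊥ ∨ N₂ = ⊥

variable (W) in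
/-- `W` has Loewy length 2: `J•W ≠ 0` and `J²•W = 0`. -/
def LoewyLen2 : Prop := radM 𝕜 m n ξ W ≠ ⊥ ∧ rad2M 𝕜 m n ξ W = ⊥

variable (W) in
/-- `W` is of `(s,t)`-type: it has Loewy length `2`, its socle has composition length `t`,
and `W/soc W` has composition length `s`. -/
def IsType (s t : ℕ) : Prop :=
  LoewyLen2 𝕜 m n ξ W ∧ lengthIs 𝕜 m n ξ (socle 𝕜 m n ξ W) t ∧
    lengthIs 𝕜 m n ξ (W ⧸ socle 𝕜 m n ξ W) s

end ModuleH

section ModuleK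

variable {V : Type} [AddCommGroup V] [Module 𝕜 V] [Module (H 𝕜 m n ξ) V]
  [IsScalarTower 𝕜 (H 𝕜 m n ξ) V]

variable (V) in
/-- `V^d = {v ∈ V | d•v = 0}`, as a `𝕜`-subspace. -/
def dKer : Submodule 𝕜 V where
  carrier := {v | hd • v = 0}
  add_mem' := by
    intro x y hx hy
    simp only [Set.mem_setOf_eq] at *
    rw [smul_add, hx, hy, add_zero]
  zero_mem' := smul_zero _
  smul_mem' := by
    intro r v hv
    simp only [Set.mem_setOf_eq] at *
    rw [smul_comm, hv, smul_zero]

variable (V) in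
/-- `V_{(i)} = {v ∈ V | c•v = ξ^i v}`, as a `𝕜`-subspace. -/
def eigsp (i : ℤ) : Submodule 𝕜 V where
  carrier := {v | hc • v = ξ ^ i • v}
  add_mem' := by
    intro x y hx hy
    simp only [Set.mem_setOf_eq] at *
    rw [smul_add, hx, hy, smul_add]
  zero_mem' := by simp
  smul_mem' := by
    intro r v hv
    simp only [Set.mem_setOf_eq] at *
    rw [smul_comm, hv, smul_comm]

/-- `V`, equipped with the family `mv : Fin l → V`, realizes the simple module `M(l,i)`:
`mv` is a basis of `V` and the generators act by the defining formulas of `M(l,i)`. -/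
def IsMrep (l : ℕ) (i : ℤ) (mv : Fin l → V) : Prop :=
  LinearIndependent 𝕜 mv ∧ Submodule.span 𝕜 (Set.range mv) = ⊤ ∧
  (∀ (j : ℕ) (hj : j + 1 < l),
    ha • mv ⟨j, by omega⟩ = alph 𝕜 m n ξ l i (j + 1) • mv ⟨j + 1, hj⟩) ∧
  (∀ (j : ℕ) (hj : j < l), j + 1 = l → ha • mv ⟨j, hj⟩ = 0) ∧
  (∀ j : Fin l, hb • mv j = ((ξ ^ m) ^ (i + (l : ℤ) - ((j : ℕ) + 1 : ℤ)) : 𝕜) • mv j) ∧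
  (∀ j : Fin l, hc • mv j = (ξ ^ (i + (j : ℕ) : ℤ) : 𝕜) • mv j) ∧
  (∀ (j : ℕ) (hj : j + 1 < l), hd • mv ⟨j + 1, hj⟩ = mv ⟨j, by omega⟩) ∧
  (∀ hl : 0 < l, hd • mv ⟨0, hl⟩ = 0)

/-- `V` realizes the induced module `Z(λ_{ij})`: there is a cyclic vector `z` with
`d•z = 0`, `b•z = ξ^j z`, `c•z = ξ^i z` such that `(a^k • z)_{0 ≤ k ≤ n-1}` is a basis. -/
def IsZrep (i j : ℤ) (V : Type) [AddCommGroup V] [Module 𝕜 V] [Module (H 𝕜 m n ξ) V]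
    [IsScalarTower 𝕜 (H 𝕜 m n ξ) V] : Prop :=
  ∃ z : V, hd • z = 0 ∧ hb • z = (ξ ^ j : 𝕜) • z ∧ hc • z = (ξ ^ i : 𝕜) • z ∧
    LinearIndependent 𝕜 (fun k : Fin n => (ha ^ (k : ℕ)) • z) ∧
    Submodule.span 𝕜 (Set.range fun k : Fin n => (ha ^ (k : ℕ)) • z) = ⊤

/-- `V`, equipped with the families `v u : Fin n → V`, realizes the projective module `P(l,i)`
with its standard basis. -/
def IsPrep (l : ℕ) (hl1 : 1 ≤ l) (hl2 : l < n) (i : ℤ) (v u : Fin n → V) : Prop :=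
  LinearIndependent 𝕜 (Sum.elim v u) ∧
  Submodule.span 𝕜 (Set.range v ∪ Set.range u) = ⊤ ∧
  (∀ (j : ℕ) (hj : j + l + 2 ≤ n),
    ha • v ⟨j, by omega⟩ = gam 𝕜 m n ξ l i (j + 1) • v ⟨j + 1, by omega⟩) ∧
  (∀ (j : ℕ) (hj : j + 1 < n), n ≤ j + 1 + l →
    ha • v ⟨j, by omega⟩ =
      gam 𝕜 m n ξ l i (j + 1) • v ⟨j + 1, hj⟩ + u ⟨j + 1 + l - n, by omega⟩) ∧
  (ha • v ⟨n - 1, by omega⟩ = gam 𝕜 m n ξ l i n • v ⟨0, by omega⟩ + u ⟨l, by omega⟩) ∧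
  (∀ (j : ℕ) (hj : j + 1 < n),
    ha • u ⟨j, by omega⟩ = alph 𝕜 m n ξ l i (j + 1) • u ⟨j + 1, hj⟩) ∧
  (ha • u ⟨n - 1, by omega⟩ = alph 𝕜 m n ξ l i n • u ⟨0, by omega⟩) ∧
  (∀ j : Fin n, hb • v j = ((ξ ^ m) ^ (i + (n : ℤ) - ((j : ℕ) + 1 : ℤ)) : 𝕜) • v j) ∧
  (∀ j : Fin n, hb • u j = ((ξ ^ m) ^ (i + (l : ℤ) - ((j : ℕ) + 1 : ℤ)) : 𝕜) • u j) ∧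
  (∀ j : Fin n, hc • v j = (ξ ^ (i - ((n : ℤ) - (l : ℤ)) + (j : ℕ) : ℤ) : 𝕜) • v j) ∧
  (∀ j : Fin n, hc • u j = (ξ ^ (i + (j : ℕ) : ℤ) : 𝕜) • u j) ∧
  (hd • v ⟨0, by omega⟩ = 0) ∧
  (∀ (j : ℕ) (hj : j + 1 < n), hd • v ⟨j + 1, hj⟩ = v ⟨j, by omega⟩) ∧
  (hd • u ⟨0, by omega⟩ = 0) ∧
  (∀ (j : ℕ) (hj : j + 1 < n), hd • u ⟨j + 1, hj⟩ = u ⟨j, by omega⟩)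

/-- `V`, equipped with the basis `e : Fin n → V`, realizes the module `T_1(l,i)`. -/
def IsT1rep (l : ℕ) (hl1 : 1 ≤ l) (hl2 : l < n) (i : ℤ) (e : Fin n → V) : Prop :=
  LinearIndependent 𝕜 e ∧ Submodule.span 𝕜 (Set.range e) = ⊤ ∧
  (∀ (j : ℕ) (hj : j + 1 < n),
    ha • e ⟨j, by omega⟩ = alph 𝕜 m n ξ l i (j + 1) • e ⟨j + 1, hj⟩) ∧
  (ha • e ⟨n - 1, by omega⟩ = alph 𝕜 m n ξ l i n • e ⟨0, by omega⟩) ∧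
  (∀ j : Fin n, hb • e j = ((ξ ^ m) ^ (i + (l : ℤ) - ((j : ℕ) + 1 : ℤ)) : 𝕜) • e j) ∧
  (∀ j : Fin n, hc • e j = (ξ ^ (i + (j : ℕ) : ℤ) : 𝕜) • e j) ∧
  (hd • e ⟨0, by omega⟩ = 0) ∧
  (∀ (j : ℕ) (hj : j + 1 < n), hd • e ⟨j + 1, hj⟩ = e ⟨j, by omega⟩)

/-- `V`, equipped with the basis `e : Fin n → V`, realizes the module `T̄_1(l,i)`. -/
def IsT1barrep (l : ℕ) (hl1 : 1 ≤ l) (hl2 : l < n) (i : ℤ) (e : Fin n → V) : Prop :=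
  LinearIndependent 𝕜 e ∧ Submodule.span 𝕜 (Set.range e) = ⊤ ∧
  (∀ (j : ℕ) (hj : j + 1 < n - l),
    ha • e ⟨j, by omega⟩ = alph 𝕜 m n ξ (n - l) (i + l - n) (j + 1) • e ⟨j + 1, by omega⟩) ∧
  (ha • e ⟨n - l - 1, by omega⟩ = e ⟨n - l, by omega⟩) ∧
  (∀ (k : ℕ) (hk : k + 1 < l),
    ha • e ⟨n - l + k, by omega⟩ = alph 𝕜 m n ξ l i (k + 1) • e ⟨n - l + k + 1, by omega⟩) ∧
  (ha • e ⟨n - 1, by omega⟩ = 0) ∧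
  (∀ j : Fin n, hb • e j = ((ξ ^ m) ^ (i - ((j : ℕ) + 1 : ℤ)) : 𝕜) • e j) ∧
  (∀ j : Fin n, hc • e j = (ξ ^ (i + (l : ℤ) - (n : ℤ) + (j : ℕ) : ℤ) : 𝕜) • e j) ∧
  (hd • e ⟨0, by omega⟩ = 0) ∧
  (∀ (j : ℕ) (hj : j + 1 < n - l), hd • e ⟨j + 1, by omega⟩ = e ⟨j, by omega⟩) ∧
  (hd • e ⟨n - l, by omega⟩ = 0) ∧
  (∀ (k : ℕ) (hk : k + 1 < l), hd • e ⟨n - l + k + 1, by omega⟩ = e ⟨n - l + k, by omega⟩)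

end ModuleK

section Matrices

/-- The nilpotent Jordan-type matrix `D_s` with `1` on the superdiagonal. -/
def Dmat (s : ℕ) : Matrix (Fin s) (Fin s) 𝕜 :=
  fun r c => if (r : ℕ) + 1 = (c : ℕ) then 1 else 0

/-- The matrix `X_{l,i}` : subdiagonal entries `γ_k(l,i)`, `(1,n)`-entry `γ_n(l,i)`. -/
def Xmat (l : ℕ) (i : ℤ) : Matrix (Fin n) (Fin n) 𝕜 := fun r c =>
  if (r : ℕ) = (c : ℕ) + 1 then gam 𝕜 m n ξ l i ((c : ℕ) + 1)
  else if (r : ℕ) = 0 ∧ (c : ℕ) = n - 1 then gam 𝕜 m n ξ l i n else 0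

/-- The matrix `Z_{l,i}` : subdiagonal entries `α_k(l,i)`, `(1,n)`-entry `α_n(l,i)`. -/
def Zmat (l : ℕ) (i : ℤ) : Matrix (Fin n) (Fin n) 𝕜 := fun r c =>
  if (r : ℕ) = (c : ℕ) + 1 then alph 𝕜 m n ξ l i ((c : ℕ) + 1)
  else if (r : ℕ) = 0 ∧ (c : ℕ) = n - 1 then alph 𝕜 m n ξ l i n else 0

/-- The block matrix `A(l,i) = [[X_{l,i}, 0], [D_n^{n-l-1}, Z_{l,i}]]`. -/
def Amat (l : ℕ) (i : ℤ) : Matrix (Fin n ⊕ Fin n) (Fin n ⊕ Fin n) 𝕜 :=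
  Matrix.fromBlocks (Xmat 𝕜 m n ξ l i) 0 (Dmat 𝕜 n ^ (n - l - 1)) (Zmat 𝕜 m n ξ l i)

/-- The diagonal matrix `B(l,i)`. -/
def Bmat (l : ℕ) (i : ℤ) : Matrix (Fin n ⊕ Fin n) (Fin n ⊕ Fin n) 𝕜 :=
  Matrix.fromBlocks
    (Matrix.diagonal fun j : Fin n => (ξ ^ m) ^ (i - ((j : ℕ) + 1 : ℤ))) 0 0
    (Matrix.diagonal fun j : Fin n => (ξ ^ m) ^ (i + (l : ℤ) - ((j : ℕ) + 1 : ℤ)))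

/-- The diagonal matrix `C(l,i)`. -/
def Cmat (l : ℕ) (i : ℤ) : Matrix (Fin n ⊕ Fin n) (Fin n ⊕ Fin n) 𝕜 :=
  Matrix.fromBlocks
    (Matrix.diagonal fun j : Fin n => ξ ^ (i + (l : ℤ) - (n : ℤ) + (j : ℕ))) 0 0
    (Matrix.diagonal fun j : Fin n => ξ ^ (i + (j : ℕ) : ℤ))

/-- The block matrix `D = diag(D_n, D_n)`. -/
def Dbig : Matrix (Fin n ⊕ Fin n) (Fin n ⊕ Fin n) 𝕜 :=
  Matrix.fromBlocks (Dmat 𝕜 n) 0 0 (Dmat 𝕜 n)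

end Matrices

/-- Relations of `H_{mn}(ξ)` in generators that are homogeneous for conjugation by `C`. The sign
`ε` makes them stable under exchanging `A` and `D`. -/
structure GradedRel {k R : Type*} [Field k] [Ring R] [Algebra k R] (m n : ℕ) (ξ ε : k)
    (A B C D : R) : Prop where
  prim : IsPrimitiveRoot ξ (m * n)
  one_lt : 1 < m
  pos : 0 < n
  A_pow : A ^ n = 0
  D_pow : D ^ n = 0
  B_pow : B ^ (m * n) = 1
  C_pow : C ^ (m * n) = 1
  AB : A * B = ξ ^ m • (B * A)
  DC : D * C = ξ • (C * D)
  BC : B * C = C * B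
  BD : B * D = ξ ^ m • (D * B)
  CA : C * A = ξ • (A * C)
  AD : A * D - D * A = ε • (B - C ^ m)
  gen : Algebra.adjoin k {A, B, C, D} = ⊤

/-- Joint eigenvectors of `B` and `C`. -/
def IsWeight {k R V : Type*} [Field k] [Ring R] [AddCommGroup V] [Module k V] [Module R V]
    (B C : R) (β γ : k) (v : V) : Prop := B • v = β • v ∧ C • v = γ • v

/-- `∑ i < r, γ⁻ⁱ Xⁱ`, a multiple of the projection onto the `γ`-eigenspace of `X` when
`X ^ r = 1`. -/
def eigProj {k R : Type*} [Field k] [Ring R] [Algebra k R] (r : ℕ) (X : R) (γ : k) : R :=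
  ∑ i ∈ Finset.range r, (γ⁻¹) ^ i • X ^ i

section Proj

variable {k R V : Type*} [Field k] [Ring R] [Algebra k R] [AddCommGroup V] [Module k V]
  [Module R V] [IsScalarTower k R V]

theorem mul_eigProj {r : ℕ} {X : R} {γ : k} (hX : X ^ r = 1) (hγ : γ ^ r = 1) (h0 : γ ≠ 0) :
    X * eigProj r X γ = γ • eigProj r X γ := by
  have h : (γ⁻¹ • X - 1) * eigProj r X γ = 0 := by
    have := mul_geom_sum (γ⁻¹ • X) r
    simp only [smul_pow, hX, inv_pow, hγ, inv_one, one_smul, sub_self] at this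
    simpa [eigProj] using this
  rw [sub_mul, one_mul, sub_eq_zero, smul_mul_assoc] at h
  conv_rhs => rw [← h, smul_smul, mul_inv_cancel₀ h0, one_smul]

theorem pow_smul_of_eigen {X : R} {δ : k} {v : V} (h : X • v = δ • v) (i : ℕ) :
    X ^ i • v = δ ^ i • v := by
  induction i with
  | zero => simp
  | succ i ih => rw [pow_succ', mul_smul, ih, ← algebraMap_smul R (δ ^ i) v, ← mul_smul,
      ← Algebra.commutes, mul_smul, h, algebraMap_smul, smul_smul, pow_succ]

theorem eigProj_smul_of_eigen {r : ℕ} {X : R} {γ δ : k} {v : V} (h : X • v = δ • v) :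
    eigProj r X γ • v = (∑ i ∈ Finset.range r, (γ⁻¹ * δ) ^ i) • v := by
  simp only [eigProj, Finset.sum_smul, smul_assoc, pow_smul_of_eigen h, smul_smul, mul_pow]

theorem eigProj_smul_self {r : ℕ} {X : R} {γ : k} {v : V} (h : X • v = γ • v) (h0 : γ ≠ 0) :
    eigProj r X γ • v = (r : k) • v := by
  simp [eigProj_smul_of_eigen h, inv_mul_cancel₀ h0]

theorem eigProj_smul_of_ne {r : ℕ} {X : R} {γ δ : k} {v : V} (h : X • v = δ • v) (h0 : γ ≠ 0)
    (hγ : γ ^ r = 1) (hδ : δ ^ r = 1) (hne : γ ≠ δ) : eigProj r X γ • v = 0 := by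
  have h1 : γ⁻¹ * δ ≠ 1 := by
    intro h
    apply hne
    field_simp at h
    exact h.symm
  have h2 := geom_sum_mul (γ⁻¹ * δ) r
  rw [mul_pow, inv_pow, hγ, hδ, inv_one, one_mul, sub_self] at h2
  rw [eigProj_smul_of_eigen h, (mul_eq_zero.1 h2).resolve_right (sub_ne_zero.2 h1), zero_smul]

theorem sum_eigProj {r : ℕ} {ξ : k} (hξ : IsPrimitiveRoot ξ r) (X : R) :
    ∑ j ∈ Finset.range r, eigProj r X (ξ ^ j) = (r : k) • (1 : R) := by
  unfold eigProj
  rw [Finset.sum_comm]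
  simp only [← Finset.sum_smul]
  rcases Nat.eq_zero_or_pos r with rfl | hr
  · simp
  rw [Finset.sum_eq_single_of_mem 0 (Finset.mem_range.2 hr)]
  · simp
  intro i hi hi0
  have h1 : (ξ⁻¹) ^ i ≠ 1 := hξ.inv.pow_ne_one_of_pos_of_lt hi0 (Finset.mem_range.1 hi)
  have h2 := geom_sum_mul ((ξ⁻¹) ^ i) r
  rw [← pow_mul, mul_comm i r, pow_mul, hξ.inv.pow_eq_one, one_pow, sub_self] at h2
  have h3 : ∑ j ∈ Finset.range r, ((ξ ^ j)⁻¹) ^ i = ∑ j ∈ Finset.range r, ((ξ⁻¹) ^ i) ^ j :=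
    Finset.sum_congr rfl fun j _ => by rw [inv_pow, ← pow_mul, ← pow_mul, inv_pow, mul_comm]
  rw [h3, (mul_eq_zero.1 h2).resolve_right (sub_ne_zero.2 h1), zero_smul]

theorem mul_eigProj_of_smul_comm {r : ℕ} {X Y : R} {ζ γ : k} (h : Y * X = ζ • (X * Y)) :
    Y * eigProj r X γ = eigProj r X (γ * ζ⁻¹) * Y := by
  have hp : ∀ i : ℕ, Y * X ^ i = ζ ^ i • (X ^ i * Y) := by
    intro i
    induction i with
    | zero => simp
    | succ i ih =>
      rw [pow_succ, ← mul_assoc, ih, smul_mul_assoc, mul_assoc, h, mul_smul_comm, smul_smul,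
        ← mul_assoc, pow_succ]
  simp only [eigProj, Finset.mul_sum, Finset.sum_mul, mul_smul_comm, smul_mul_assoc, hp, smul_smul,
    mul_inv, inv_inv, mul_pow]

end Proj

namespace GradedRel

variable {k R V : Type*} [Field k] [Ring R] [Algebra k R] [AddCommGroup V] [Module k V]
  [Module R V] [IsScalarTower k R V] {m n : ℕ} {ξ ε : k} {A B C D : R}

theorem swap (h : GradedRel m n ξ ε A B C D) : GradedRel m n ξ⁻¹ (-ε) D B C A := by
  have h0 : ξ ≠ 0 := h.prim.ne_zero (Nat.mul_pos (by have := h.one_lt; omega) h.pos).ne'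
  have h1 : ξ ^ m ≠ 0 := pow_ne_zero _ h0
  refine ⟨h.prim.inv, h.one_lt, h.pos, h.D_pow, h.A_pow, h.B_pow, h.C_pow, ?_, ?_, h.BC, ?_, ?_,
    ?_, ?_⟩
  · rw [h.BD, smul_smul, inv_pow, inv_mul_cancel₀ h1, one_smul]
  · rw [h.CA, smul_smul, inv_mul_cancel₀ h0, one_smul]
  · rw [h.AB, smul_smul, inv_pow, inv_mul_cancel₀ h1, one_smul]
  · rw [h.DC, smul_smul, inv_mul_cancel₀ h0, one_smul]
  · rw [neg_smul, ← h.AD, neg_sub]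
  · rw [← h.gen]
    congr 1
    ext x
    simp only [Set.mem_insert_iff, Set.mem_singleton_iff]
    tauto

theorem op (h : GradedRel m n ξ ε A B C D) :
    GradedRel m n ξ ε (MulOpposite.op D) (MulOpposite.op B) (MulOpposite.op C)
      (MulOpposite.op A) := by
  refine ⟨h.prim, h.one_lt, h.pos, ?_, ?_, ?_, ?_, ?_, ?_, ?_, ?_, ?_, ?_, ?_⟩
  · rw [← MulOpposite.op_pow, h.D_pow, MulOpposite.op_zero]
  · rw [← MulOpposite.op_pow, h.A_pow, MulOpposite.op_zero]
  · rw [← MulOpposite.op_pow, h.B_pow, MulOpposite.op_one]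
  · rw [← MulOpposite.op_pow, h.C_pow, MulOpposite.op_one]
  · rw [← MulOpposite.op_mul, ← MulOpposite.op_mul, h.BD, MulOpposite.op_smul]
  · rw [← MulOpposite.op_mul, ← MulOpposite.op_mul, h.CA, MulOpposite.op_smul]
  · rw [← MulOpposite.op_mul, ← MulOpposite.op_mul, h.BC]
  · rw [← MulOpposite.op_mul, ← MulOpposite.op_mul, h.AB, MulOpposite.op_smul]
  · rw [← MulOpposite.op_mul, ← MulOpposite.op_mul, h.DC, MulOpposite.op_smul]
  · rw [← MulOpposite.op_mul, ← MulOpposite.op_mul, ← MulOpposite.op_sub, h.AD,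
      MulOpposite.op_smul, MulOpposite.op_sub, MulOpposite.op_pow]
  · rw [eq_top_iff]
    intro x _
    have hx : x.unop ∈ Algebra.adjoin k {A, B, C, D} := by rw [h.gen]; trivial
    have hA : ∀ y ∈ Algebra.adjoin k {A, B, C, D}, MulOpposite.op y ∈ Algebra.adjoin k
        {MulOpposite.op D, MulOpposite.op B, MulOpposite.op C, MulOpposite.op A} := by
      intro y hy
      induction hy using Algebra.adjoin_induction with
      | mem y hy =>
        apply Algebra.subset_adjoin
        simp only [Set.mem_insert_iff, Set.mem_singleton_iff] at hy ⊢
        rcases hy with rfl | rfl | rfl | rfl <;> simp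
      | algebraMap c => exact Subalgebra.algebraMap_mem _ c
      | add y z _ _ hy hz => exact add_mem hy hz
      | mul y z _ _ hy hz => exact mul_mem hz hy
    exact hA _ hx

theorem xi_ne_zero (h : GradedRel m n ξ ε A B C D) : ξ ≠ 0 :=
  h.prim.ne_zero (Nat.mul_pos (by have := h.one_lt; omega) h.pos).ne'

theorem n_lt (h : GradedRel m n ξ ε A B C D) : n < m * n := by
  have := h.one_lt
  have := h.pos
  nlinarith

theorem natCast_ne_zero (h : GradedRel m n ξ ε A B C D) : ((m * n : ℕ) : k) ≠ 0 := by
  have : NeZero (m * n) := ⟨by have := h.n_lt; omega⟩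
  exact (h.prim.neZero').ne

theorem smul_mem_of_invariant (h : GradedRel m n ξ ε A B C D) (p : Submodule k V)
    (hA : ∀ x ∈ p, A • x ∈ p) (hB : ∀ x ∈ p, B • x ∈ p) (hC : ∀ x ∈ p, C • x ∈ p)
    (hD : ∀ x ∈ p, D • x ∈ p) (r : R) : ∀ x ∈ p, r • x ∈ p := by
  have hr : r ∈ Algebra.adjoin k {A, B, C, D} := by rw [h.gen]; trivial
  induction hr using Algebra.adjoin_induction with
  | mem y hy =>
    simp only [Set.mem_insert_iff, Set.mem_singleton_iff] at hy
    rcases hy with rfl | rfl | rfl | rfl <;> assumption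
  | algebraMap c => intro x hx; rw [algebraMap_smul]; exact p.smul_mem c hx
  | add y z _ _ hy hz => intro x hx; rw [add_smul]; exact add_mem (hy x hx) (hz x hx)
  | mul y z _ _ hy hz => intro x hx; rw [mul_smul]; exact hy _ (hz x hx)

theorem isWeight_A (h : GradedRel m n ξ ε A B C D) {β γ : k} {v : V} (hv : IsWeight B C β γ v) :
    IsWeight B C ((ξ ^ m)⁻¹ * β) (ξ * γ) (A • v) := by
  have h1 : ξ ^ m ≠ 0 := pow_ne_zero _ h.xi_ne_zero
  constructor
  · have : B * A = (ξ ^ m)⁻¹ • (A * B) := by rw [h.AB, smul_smul, inv_mul_cancel₀ h1, one_smul]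
    rw [← mul_smul, this, smul_assoc, mul_smul, hv.1, smul_comm A β, smul_smul]
  · rw [← mul_smul, h.CA, smul_assoc, mul_smul, hv.2, smul_comm A γ, smul_smul]

theorem isWeight_D (h : GradedRel m n ξ ε A B C D) {β γ : k} {v : V} (hv : IsWeight B C β γ v) :
    IsWeight B C (ξ ^ m * β) (ξ⁻¹ * γ) (D • v) := by
  simpa using h.swap.isWeight_A hv

theorem isWeight_A_pow (h : GradedRel m n ξ ε A B C D) {β γ : k} {v : V}
    (hv : IsWeight B C β γ v) (i : ℕ) :
    IsWeight B C (((ξ ^ m)⁻¹) ^ i * β) (ξ ^ i * γ) (A ^ i • v) := by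
  induction i with
  | zero => simpa using hv
  | succ i ih =>
    have := h.isWeight_A ih
    rw [← mul_smul, ← pow_succ', ← mul_assoc, ← mul_assoc, ← pow_succ', ← pow_succ'] at this
    exact this

theorem D_smul_A_smul (h : GradedRel m n ξ ε A B C D) {β γ : k} {v : V}
    (hv : IsWeight B C β γ v) : ∃ μ : k, D • A • v = A • D • v + μ • v := by
  refine ⟨-(ε * (β - γ ^ m)), ?_⟩
  have h1 : A • D • v - D • A • v = (ε * (β - γ ^ m)) • v := by
    rw [← mul_smul, ← mul_smul, ← sub_smul, h.AD, smul_assoc, sub_smul, hv.1,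
      pow_smul_of_eigen hv.2, ← sub_smul, smul_smul]
  rw [neg_smul, ← h1]
  abel

theorem D_smul_A_pow_smul (h : GradedRel m n ξ ε A B C D) {β γ : k} {v : V}
    (hv : IsWeight B C β γ v) (i : ℕ) :
    ∃ μ : k, D • A ^ (i + 1) • v = A ^ (i + 1) • D • v + μ • A ^ i • v := by
  induction i with
  | zero => simpa using h.D_smul_A_smul hv
  | succ i ih =>
    obtain ⟨μ, hμ⟩ := ih
    obtain ⟨ν, hν⟩ := h.D_smul_A_smul (h.isWeight_A_pow hv (i + 1))
    refine ⟨μ + ν, ?_⟩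
    rw [pow_succ' A (i + 1), mul_smul, hν, hμ, smul_add, add_assoc, smul_comm A μ,
      ← mul_smul A (A ^ i), ← pow_succ', add_smul, mul_smul]

theorem mem_span_A_pow (h : GradedRel m n ξ ε A B C D) {β γ : k} {z : V}
    (hz : IsWeight B C β γ z) (hD : D • z = 0) {x : V} (hx : x ∈ Submodule.span R {z}) :
    x ∈ Submodule.span k (Set.range fun i : ℕ => A ^ i • z) := by
  set p := Submodule.span k (Set.range fun i : ℕ => A ^ i • z) with hp
  have hmem : ∀ i, A ^ i • z ∈ p := fun i => Submodule.subset_span ⟨i, rfl⟩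
  have key : ∀ Y : R, (∀ i, Y • A ^ i • z ∈ p) → ∀ x ∈ p, Y • x ∈ p := by
    intro Y hY x hx
    induction hx using Submodule.span_induction with
    | mem x hx => obtain ⟨i, rfl⟩ := hx; exact hY i
    | zero => rw [smul_zero]; exact zero_mem _
    | add x y _ _ hx hy => rw [smul_add]; exact add_mem hx hy
    | smul c x _ hx => rw [smul_comm]; exact p.smul_mem c hx
  obtain ⟨r, rfl⟩ := Submodule.mem_span_singleton.1 hx
  refine h.smul_mem_of_invariant p (key A ?_) (key B ?_) (key C ?_) (key D ?_) r z
    (by simpa using hmem 0)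
  · intro i; rw [← mul_smul, ← pow_succ']; exact hmem _
  · intro i; rw [(h.isWeight_A_pow hz i).1]; exact p.smul_mem _ (hmem i)
  · intro i; rw [(h.isWeight_A_pow hz i).2]; exact p.smul_mem _ (hmem i)
  · intro i
    cases i with
    | zero => simp [hD]
    | succ i =>
      obtain ⟨μ, hμ⟩ := h.D_smul_A_pow_smul hz i
      rw [hμ, hD, smul_zero, zero_add]
      exact p.smul_mem _ (hmem i)

theorem eigProj_A_pow_smul (h : GradedRel m n ξ ε A B C D) {β γ : k} {z : V}
    (hz : IsWeight B C β γ z) (hγ : γ ^ (m * n) = 1) {i : ℕ} (hi : 0 < i) :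
    eigProj (m * n) C γ • A ^ i • z = 0 := by
  rcases lt_or_ge i n with hin | hin
  · have hmn := h.n_lt
    have h0 : γ ≠ 0 := by rintro rfl; rw [zero_pow (by omega)] at hγ; exact zero_ne_one hγ
    refine eigProj_smul_of_ne (h.isWeight_A_pow hz i).2 h0 hγ ?_ ?_
    · rw [mul_pow, hγ, ← pow_mul, mul_comm i, pow_mul, h.prim.pow_eq_one, one_pow, mul_one]
    · intro h_c
      have : ξ ^ i = 1 := mul_right_cancel₀ h0 (by rw [one_mul]; exact h_c.symm)
      exact h.prim.pow_ne_one_of_pos_of_lt hi.ne' (by omega) this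
  · rw [pow_eq_zero_of_le hin h.A_pow, zero_smul, smul_zero]

theorem ne_zero_of_pow_eq_one (h : GradedRel m n ξ ε A B C D) {γ : k} (hγ : γ ^ (m * n) = 1) :
    γ ≠ 0 := by
  have := h.n_lt
  rintro rfl
  rw [zero_pow (by omega)] at hγ
  exact zero_ne_one hγ

theorem eigProj_smul_mem (h : GradedRel m n ξ ε A B C D) {β γ : k} {z : V}
    (hz : IsWeight B C β γ z) (hγ : γ ^ (m * n) = 1) (hD : D • z = 0) {x : V}
    (hx : x ∈ Submodule.span R {z}) : ∃ a : k, eigProj (m * n) C γ • x = a • z := by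
  have hx' := h.mem_span_A_pow hz hD hx
  clear hx
  induction hx' using Submodule.span_induction with
  | mem x hx =>
    obtain ⟨i, rfl⟩ := hx
    rcases Nat.eq_zero_or_pos i with rfl | hi
    · exact ⟨(m * n : ℕ), by
        simpa only [pow_zero, one_smul] using eigProj_smul_self hz.2 (h.ne_zero_of_pow_eq_one hγ)⟩
    · exact ⟨0, by simp [h.eigProj_A_pow_smul hz hγ hi]⟩
  | zero => exact ⟨0, by simp⟩
  | add x y _ _ hx hy =>
    obtain ⟨a, h_a⟩ := hx
    obtain ⟨b, h_b⟩ := hy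
    exact ⟨a + b, by rw [smul_add, h_a, h_b, add_smul]⟩
  | smul c x _ hx =>
    obtain ⟨a, h_a⟩ := hx
    exact ⟨c * a, by rw [smul_comm, h_a, mul_smul]⟩

/-- In a semisimple module a weight vector killed by `D` is zero or generates a simple module. -/
theorem span_eq_bot_or_isAtom (h : GradedRel m n ξ ε A B C D) {N : Submodule R V}
    (hN : ∀ U ≤ N, ∃ U', U ⊓ U' = ⊥ ∧ U ⊔ U' = N) {β γ : k} {z : V}
    (hz : IsWeight B C β γ z) (hγ : γ ^ (m * n) = 1) (hD : D • z = 0) (hzN : z ∈ N) :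
    Submodule.span R {z} = ⊥ ∨ IsAtom (Submodule.span R {z}) := by
  set T := Submodule.span R {z} with hT
  have hzT : z ∈ T := Submodule.mem_span_singleton_self z
  have hTN : T ≤ N := (Submodule.span_singleton_le_iff_mem _ _).2 hzN
  refine or_iff_not_imp_left.2 fun hne => ⟨hne, fun U hU => ?_⟩
  obtain ⟨U', h_d, hs⟩ := hN U (hU.le.trans hTN)
  have hsum : U ⊔ U' ⊓ T = T := by
    rw [← sup_inf_assoc_of_le U' hU.le, hs, inf_eq_right.2 hTN]
  obtain ⟨u, hu, u', hu', huu⟩ := Submodule.mem_sup.1 (show z ∈ U ⊔ U' ⊓ T by rw [hsum]; exact hzT)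
  obtain ⟨a, h_a⟩ := h.eigProj_smul_mem hz hγ hD (hU.le hu)
  have hau : a • z ∈ U := h_a ▸ U.smul_mem _ hu
  have ha0 : a = 0 := by
    by_contra ha0
    apply hU.not_ge
    rw [hT, Submodule.span_singleton_le_iff_mem]
    have := U.smul_of_tower_mem a⁻¹ hau
    rwa [smul_smul, inv_mul_cancel₀ ha0, one_smul] at this
  have hz' : ((m * n : ℕ) : k) • z ∈ U' := by
    rw [← eigProj_smul_self (r := m * n) hz.2 (h.ne_zero_of_pow_eq_one hγ), ← huu, smul_add, h_a,
      ha0, zero_smul, zero_add]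
    exact U'.smul_mem _ hu'.1
  have hz'' : z ∈ U' := by
    have := U'.smul_of_tower_mem ((m * n : ℕ) : k)⁻¹ hz'
    rwa [smul_smul, inv_mul_cancel₀ h.natCast_ne_zero, one_smul] at this
  have hTU' : T ≤ U' := (Submodule.span_singleton_le_iff_mem _ _).2 hz''
  rw [eq_bot_iff, ← h_d]
  exact le_inf le_rfl (hU.le.trans hTU')

theorem exists_eigProj_smul_notMem (h : GradedRel m n ξ ε A B C D) (X : R) {N : Submodule R V}
    {x : V} (hx : x ∉ N) : ∃ j : ℕ, eigProj (m * n) X (ξ ^ j) • x ∉ N := by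
  by_contra! hall
  apply hx
  have h1 : ((m * n : ℕ) : k) • x ∈ N := by
    have := N.sum_mem (t := Finset.range (m * n)) fun j _ => hall j
    rwa [← Finset.sum_smul, sum_eigProj h.prim X, smul_assoc, one_smul] at this
  have := N.smul_of_tower_mem ((m * n : ℕ) : k)⁻¹ h1
  rwa [smul_smul, inv_mul_cancel₀ h.natCast_ne_zero, one_smul] at this

theorem xi_pow_pow (h : GradedRel m n ξ ε A B C D) (j : ℕ) : (ξ ^ j) ^ (m * n) = 1 := by
  rw [← pow_mul, mul_comm, pow_mul, h.prim.pow_eq_one, one_pow]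

theorem exists_weight (h : GradedRel m n ξ ε A B C D) {N S : Submodule R V} (hNS : N < S) :
    ∃ z ∈ S, z ∉ N ∧ D • z ∈ N ∧
      ∃ β γ : k, β ^ (m * n) = 1 ∧ γ ^ (m * n) = 1 ∧ IsWeight B C β γ z := by
  obtain ⟨x, hxS, hxN⟩ := SetLike.exists_of_lt hNS
  obtain ⟨x, hxS, hxN, hDx⟩ : ∃ x ∈ S, x ∉ N ∧ D • x ∈ N := by
    classical
    have hex : ∃ i, D ^ i • x ∈ N := ⟨n, by rw [h.D_pow, zero_smul]; exact N.zero_mem⟩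
    obtain ⟨i, hi⟩ : ∃ i, Nat.find hex = i + 1 := Nat.exists_eq_succ_of_ne_zero fun h0 =>
      hxN (by simpa [h0] using Nat.find_spec hex)
    refine ⟨D ^ i • x, S.smul_mem _ hxS, Nat.find_min hex (by omega), ?_⟩
    rw [← mul_smul, ← pow_succ', ← hi]
    exact Nat.find_spec hex
  obtain ⟨j, hj⟩ := h.exists_eigProj_smul_notMem B hxN
  obtain ⟨l, hl⟩ := h.exists_eigProj_smul_notMem C hj
  have hB := mul_eigProj h.B_pow (h.xi_pow_pow j) (pow_ne_zero j h.xi_ne_zero)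
  have hC := mul_eigProj h.C_pow (h.xi_pow_pow l) (pow_ne_zero l h.xi_ne_zero)
  refine ⟨_, S.smul_mem _ (S.smul_mem _ hxS), hl, ?_, _, _, h.xi_pow_pow j, h.xi_pow_pow l, ?_, ?_⟩
  · rw [← mul_smul, mul_eigProj_of_smul_comm h.DC, mul_smul, ← mul_smul D,
      mul_eigProj_of_smul_comm h.swap.AB, mul_smul]
    exact N.smul_mem _ (N.smul_mem _ hDx)
  · have hBC : B * C = (1 : k) • (C * B) := by rw [one_smul, h.BC]
    rw [← mul_smul, mul_eigProj_of_smul_comm hBC, inv_one, mul_one, mul_smul, ← mul_smul B, hB,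
      smul_assoc, smul_comm]
  · rw [← mul_smul, hC, smul_assoc]

theorem isAtom_exists (h : GradedRel m n ξ ε A B C D) {T : Submodule R V} (hT : IsAtom T) {w : V}
    (hw : w ∈ T) : ∃ x ∈ T, A • (w - D • x) = 0 := by
  obtain ⟨z, hzT, hz0, hDz, β, γ, -, hγ, hz⟩ := h.exists_weight (bot_lt_iff_ne_bot.2 hT.1)
  rw [Submodule.mem_bot] at hz0 hDz
  have hspan : ∀ y ∈ T, y ≠ 0 → Submodule.span R {y} = T := by
    intro y hy hy0
    have hle : Submodule.span R {y} ≤ T := (Submodule.span_singleton_le_iff_mem _ _).2 hy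
    refine (hT.le_iff.1 hle).resolve_left ?_
    rwa [Submodule.span_singleton_eq_bot]
  rw [← hspan z hzT hz0] at hw
  have hw' := h.mem_span_A_pow hz hDz hw
  clear hw
  induction hw' using Submodule.span_induction with
  | mem x hx =>
    obtain ⟨i, rfl⟩ := hx
    dsimp only
    by_cases hA : A ^ (i + 1) • z = 0
    · exact ⟨0, zero_mem _, by rw [smul_zero, sub_zero, ← mul_smul, ← pow_succ', hA]⟩
    obtain ⟨μ, hμ⟩ := h.D_smul_A_pow_smul hz i
    rw [hDz, smul_zero, zero_add] at hμ
    have hμ0 : μ ≠ 0 := by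
      rintro rfl
      rw [zero_smul] at hμ
      have hzy : z ∈ Submodule.span R {A ^ (i + 1) • z} := by
        rw [hspan _ (T.smul_mem _ hzT) hA]; exact hzT
      have hzy := h.mem_span_A_pow (h.isWeight_A_pow hz (i + 1)) hμ hzy
      have hkill : ∀ x ∈ Submodule.span k (Set.range fun j : ℕ => A ^ j • A ^ (i + 1) • z),
          eigProj (m * n) C γ • x = 0 := by
        intro x hx
        induction hx using Submodule.span_induction with
        | mem x hx =>
          obtain ⟨j, rfl⟩ := hx
          dsimp only
          rw [← mul_smul (A ^ j), ← pow_add]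
          exact h.eigProj_A_pow_smul hz hγ (by omega)
        | zero => exact smul_zero _
        | add x y _ _ hx hy => rw [smul_add, hx, hy, add_zero]
        | smul c x _ hx => rw [smul_comm, hx, smul_zero]
      have := hkill z hzy
      rw [eigProj_smul_self hz.2 (h.ne_zero_of_pow_eq_one hγ)] at this
      exact hz0 ((smul_eq_zero.1 this).resolve_left h.natCast_ne_zero)
    refine ⟨μ⁻¹ • A ^ (i + 1) • z, T.smul_of_tower_mem _ (T.smul_mem _ hzT), ?_⟩
    rw [smul_comm D, hμ, smul_smul, inv_mul_cancel₀ hμ0, one_smul, sub_self, smul_zero]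
  | zero => exact ⟨0, zero_mem _, by simp⟩
  | add x y _ _ hx hy =>
    obtain ⟨u, hu, hxu⟩ := hx
    obtain ⟨v, hv, hyv⟩ := hy
    refine ⟨u + v, add_mem hu hv, ?_⟩
    rw [smul_add, add_sub_add_comm, smul_add, hxu, hyv, add_zero]
  | smul c x _ hx =>
    obtain ⟨u, hu, hxu⟩ := hx
    refine ⟨c • u, T.smul_of_tower_mem _ hu, ?_⟩
    rw [smul_comm D, ← smul_sub, smul_comm, hxu, smul_zero]

theorem semisimple_exists [WellFoundedLT (Submodule R V)] (h : GradedRel m n ξ ε A B C D)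
    {N : Submodule R V} (hN : ∀ U ≤ N, ∃ U', U ⊓ U' = ⊥ ∧ U ⊔ U' = N) (U : Submodule R V)
    (hU : U ≤ N) : ∀ w ∈ U, ∃ x ∈ N, A • (w - D • x) = 0 := by
  induction U using WellFoundedLT.induction with
  | ind U ih =>
  intro w hw
  rcases eq_or_ne U ⊥ with rfl | hne
  · rw [Submodule.mem_bot] at hw
    exact ⟨0, zero_mem _, by simp [hw]⟩
  have := isAtomic_of_orderBot_wellFounded_lt (α := Submodule R V) wellFounded_lt
  obtain ⟨T, hT, hTU⟩ := (eq_bot_or_exists_atom_le U).resolve_left hne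
  obtain ⟨U', h_d, hs⟩ := hN T (hTU.trans hU)
  have hsum : T ⊔ U' ⊓ U = U := by
    rw [← sup_inf_assoc_of_le U' hTU, hs, inf_eq_right.2 hU]
  have hlt : U' ⊓ U < U := by
    refine lt_of_le_of_ne inf_le_right fun he => hT.1 ?_
    rw [eq_bot_iff, ← h_d]
    exact le_inf le_rfl (hTU.trans (inf_eq_right.1 he))
  rw [← hsum] at hw
  obtain ⟨t, ht, u, hu, rfl⟩ := Submodule.mem_sup.1 hw
  obtain ⟨x, hx, hxt⟩ := h.isAtom_exists hT ht
  obtain ⟨y, hy, hyu⟩ := ih _ hlt (inf_le_right.trans hU) u hu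
  refine ⟨x + y, add_mem (hU (hTU hx)) hy, ?_⟩
  rw [smul_add, add_sub_add_comm, smul_add, hxt, hyu, add_zero]

/-- A weight vector generating `S` modulo the semisimple submodule `N` can be lifted so that
`A • D • z = 0`. -/
theorem exists_adjusted_weight [WellFoundedLT (Submodule R V)] (h : GradedRel m n ξ ε A B C D)
    {N S : Submodule R V} (hN : ∀ U ≤ N, ∃ U', U ⊓ U' = ⊥ ∧ U ⊔ U' = N) (hNS : N < S) :
    ∃ z ∈ S, z ∉ N ∧ D • z ∈ N ∧ A • D • z = 0 ∧
      ∃ β γ : k, γ ^ (m * n) = 1 ∧ IsWeight B C β γ z := by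
  obtain ⟨z, hzS, hzN, hDz, β, γ, hβ, hγ, hz⟩ := h.exists_weight hNS
  obtain ⟨x, hx, hAx⟩ := h.semisimple_exists hN N le_rfl _ hDz
  have hB := mul_eigProj h.B_pow hβ (h.ne_zero_of_pow_eq_one hβ)
  have hC := mul_eigProj h.C_pow hγ (h.ne_zero_of_pow_eq_one hγ)
  have hez : eigProj (m * n) C γ • eigProj (m * n) B β • z =
      (((m * n : ℕ) : k) * ((m * n : ℕ) : k)) • z := by
    rw [eigProj_smul_self hz.1 (h.ne_zero_of_pow_eq_one hβ), smul_comm,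
      eigProj_smul_self hz.2 (h.ne_zero_of_pow_eq_one hγ), smul_smul]
  have hADB : (A * D) * B = (1 : k) • (B * (A * D)) := by
    rw [mul_assoc, h.swap.AB, mul_smul_comm, ← mul_assoc, h.AB, smul_mul_assoc, smul_smul,
      ← mul_pow, inv_mul_cancel₀ h.xi_ne_zero, one_pow, mul_assoc]
  have hADC : (A * D) * C = (1 : k) • (C * (A * D)) := by
    rw [mul_assoc, h.DC, mul_smul_comm, ← mul_assoc, h.swap.DC, smul_mul_assoc, smul_smul,
      mul_inv_cancel₀ h.xi_ne_zero, mul_assoc]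
  have hzx : eigProj (m * n) C γ • eigProj (m * n) B β • (z - x) =
      (((m * n : ℕ) : k) * ((m * n : ℕ) : k)) • z -
        eigProj (m * n) C γ • eigProj (m * n) B β • x := by
    rw [smul_sub, smul_sub, hez]
  have hexN : eigProj (m * n) C γ • eigProj (m * n) B β • x ∈ N :=
    N.smul_mem _ (N.smul_mem _ hx)
  refine ⟨eigProj (m * n) C γ • eigProj (m * n) B β • (z - x), ?_, ?_, ?_, ?_, β, γ, hγ, ?_, ?_⟩
  · exact S.smul_mem _ (S.smul_mem _ (sub_mem hzS (hNS.le hx)))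
  · intro hmem
    rw [hzx, N.sub_mem_iff_left hexN] at hmem
    have := N.smul_of_tower_mem (((m * n : ℕ) : k) * ((m * n : ℕ) : k))⁻¹ hmem
    rw [smul_smul, inv_mul_cancel₀ (mul_ne_zero h.natCast_ne_zero h.natCast_ne_zero),
      one_smul] at this
    exact hzN this
  · rw [hzx, smul_sub, smul_comm]
    exact sub_mem (N.smul_of_tower_mem _ hDz) (N.smul_mem _ hexN)
  · rw [← mul_smul A D, ← mul_smul, mul_eigProj_of_smul_comm hADC, mul_smul, ← mul_smul (A * D),
      mul_eigProj_of_smul_comm hADB, mul_smul, mul_smul, smul_sub D, hAx, smul_zero, smul_zero]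
  · have hBC : B * C = (1 : k) • (C * B) := by rw [one_smul, h.BC]
    rw [← mul_smul, mul_eigProj_of_smul_comm hBC, inv_one, mul_one, mul_smul, ← mul_smul B, hB,
      smul_assoc, smul_comm]
  · rw [← mul_smul, hC, smul_assoc]

/-- Every simple submodule `S / N` of `V / N`, with `N` semisimple, lifts to a submodule `L` of `V`
such that `L ⊓ N` has length at most two. -/
theorem exists_lift [WellFoundedLT (Submodule R V)] (h : GradedRel m n ξ ε A B C D)
    {N S : Submodule R V} (hN : ∀ U ≤ N, ∃ U', U ⊓ U' = ⊥ ∧ U ⊔ U' = N) (hNS : N ⋖ S) :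
    ∃ L ≤ S, L ⊔ N = S ∧ ∃ K₁ K₂ : Submodule R V, (K₁ = ⊥ ∨ IsAtom K₁) ∧ (K₂ = ⊥ ∨ IsAtom K₂) ∧
      L ⊓ N = K₁ ⊔ K₂ := by
  classical
  obtain ⟨z, hzS, hzN, hDz, hAD, β, γ, hγ, hz⟩ := h.exists_adjusted_weight hN hNS.lt
  have hex : ∃ i, A ^ i • z ∈ N := ⟨n, by rw [h.A_pow, zero_smul]; exact N.zero_mem⟩
  obtain ⟨i, hi⟩ : ∃ i, Nat.find hex = i + 1 := Nat.exists_eq_succ_of_ne_zero fun h0 =>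
      hzN (by simpa [h0] using Nat.find_spec hex)
  have hin : i + 1 ≤ n := hi ▸ Nat.find_min' hex (by rw [h.A_pow, zero_smul]; exact N.zero_mem)
  have hyN : A ^ (i + 1) • z ∈ N := hi ▸ Nat.find_spec hex
  have hlow : ∀ j ≤ i, A ^ j • z ∉ N := fun j hj => Nat.find_min hex (by omega)
  have hAD' : ∀ j, A ^ (j + 1) • D • z = 0 := fun j => by
    rw [pow_succ, mul_smul, hAD, smul_zero]
  have hDy : D • A ^ (i + 1) • z = 0 := by
    obtain ⟨μ, hμ⟩ := h.D_smul_A_pow_smul hz i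
    rw [hAD', zero_add] at hμ
    have hmem : μ • A ^ i • z ∈ N := hμ ▸ N.smul_mem D hyN
    rcases eq_or_ne μ 0 with rfl | hμ0
    · rw [hμ, zero_smul]
    · have := N.smul_of_tower_mem μ⁻¹ hmem
      rw [smul_smul, inv_mul_cancel₀ hμ0, one_smul] at this
      exact absurd this (hlow i le_rfl)
  have hγξ : ∀ j : ℕ, (ξ ^ j * γ) ^ (m * n) = 1 := fun j => by
    rw [mul_pow, hγ, h.xi_pow_pow, one_mul]
  have hγξ' : (ξ⁻¹ * γ) ^ (m * n) = 1 := by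
    rw [mul_pow, hγ, inv_pow, h.prim.pow_eq_one, inv_one, one_mul]
  have hzL : z ∈ Submodule.span R {z} := Submodule.mem_span_singleton_self z
  refine ⟨Submodule.span R {z}, (Submodule.span_singleton_le_iff_mem _ _).2 hzS, ?_,
    Submodule.span R {D • z}, Submodule.span R {A ^ (i + 1) • z},
    h.swap.span_eq_bot_or_isAtom hN (h.isWeight_D hz) hγξ' hAD hDz,
    h.span_eq_bot_or_isAtom hN (h.isWeight_A_pow hz (i + 1)) (hγξ _) hDy hyN, ?_⟩
  · refine (hNS.eq_or_eq le_sup_right (sup_le ?_ hNS.le)).resolve_left fun he => hzN ?_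
    · exact (Submodule.span_singleton_le_iff_mem _ _).2 hzS
    · rw [← he]; exact Submodule.mem_sup_left hzL
  set K := Submodule.span R {D • z} ⊔ Submodule.span R {A ^ (i + 1) • z} with hK
  have hwK : D • z ∈ K := Submodule.mem_sup_left (Submodule.mem_span_singleton_self _)
  have hyK : A ^ (i + 1) • z ∈ K := Submodule.mem_sup_right (Submodule.mem_span_singleton_self _)
  have hKN : K ≤ N := sup_le ((Submodule.span_singleton_le_iff_mem _ _).2 hDz)
    ((Submodule.span_singleton_le_iff_mem _ _).2 hyN)
  apply le_antisymm
  · rintro x ⟨hxL, hxN⟩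
    set p := K.restrictScalars k ⊔
      Submodule.span k (Set.range fun j : Fin (i + 1) => A ^ (j : ℕ) • z) with hp
    have hKp : ∀ x ∈ K, x ∈ p := fun x hx => Submodule.mem_sup_left hx
    have hmem : ∀ j ≤ i, A ^ j • z ∈ p := fun j hj =>
      Submodule.mem_sup_right (Submodule.subset_span ⟨⟨j, by omega⟩, rfl⟩)
    have key : ∀ Y : R, (∀ j ≤ i, Y • A ^ j • z ∈ p) → ∀ x ∈ p, Y • x ∈ p := by
      intro Y hY x hx
      obtain ⟨u, hu, v, hv, rfl⟩ := Submodule.mem_sup.1 hx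
      rw [smul_add]
      refine add_mem (hKp _ (K.smul_mem _ hu)) ?_
      clear hx
      induction hv using Submodule.span_induction with
      | mem x hx => obtain ⟨j, rfl⟩ := hx; exact hY j (by omega)
      | zero => rw [smul_zero]; exact zero_mem _
      | add x y _ _ hx hy => rw [smul_add]; exact add_mem hx hy
      | smul c x _ hx => rw [smul_comm]; exact p.smul_mem c hx
    obtain ⟨r, rfl⟩ := Submodule.mem_span_singleton.1 hxL
    have hrz := h.smul_mem_of_invariant p (key A ?_) (key B ?_) (key C ?_) (key D ?_) r z
      (by simpa using hmem 0 (Nat.zero_le _))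
    rotate_left
    · intro j hj
      rw [← mul_smul, ← pow_succ']
      rcases hj.lt_or_eq with hj | rfl
      · exact hmem _ hj
      · exact hKp _ hyK
    · intro j hj; rw [(h.isWeight_A_pow hz j).1]; exact p.smul_mem _ (hmem j hj)
    · intro j hj; rw [(h.isWeight_A_pow hz j).2]; exact p.smul_mem _ (hmem j hj)
    · intro j hj
      cases j with
      | zero => rw [pow_zero, one_smul]; exact hKp _ hwK
      | succ j =>
        obtain ⟨μ, hμ⟩ := h.D_smul_A_pow_smul hz j
        rw [hμ, hAD', zero_add]
        exact p.smul_mem _ (hmem j (by omega))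
    obtain ⟨u, hu, v, hv, huv⟩ := Submodule.mem_sup.1 hrz
    have hu : u ∈ K := hu
    have hvN : v ∈ N := by
      rw [← huv] at hxN
      exact (N.add_mem_iff_right (hKN hu)).1 hxN
    obtain ⟨a, rfl⟩ := (Submodule.mem_span_range_iff_exists_fun k).1 hv
    have h_a : ∀ j, a j = 0 := by
      intro j
      have hproj : eigProj (m * n) C (ξ ^ (j : ℕ) * γ) • ∑ l, a l • A ^ (l : ℕ) • z =
          (((m * n : ℕ) : k) * a j) • A ^ (j : ℕ) • z := by
        rw [Finset.smul_sum, Finset.sum_eq_single_of_mem j (Finset.mem_univ j)]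
        · rw [smul_comm, eigProj_smul_self (h.isWeight_A_pow hz j).2
            (h.ne_zero_of_pow_eq_one (hγξ j)), smul_smul, mul_comm]
        · intro l _ hlj
          rw [smul_comm, eigProj_smul_of_ne (h.isWeight_A_pow hz l).2
            (h.ne_zero_of_pow_eq_one (hγξ j)) (hγξ j) (hγξ l), smul_zero]
          intro he
          have he := mul_right_cancel₀ (h.ne_zero_of_pow_eq_one hγ) he
          have hmn := h.n_lt
          exact hlj (Fin.ext (h.prim.pow_inj (by omega) (by omega) he).symm)
      by_contra ha0
      have hm := N.smul_mem (eigProj (m * n) C (ξ ^ (j : ℕ) * γ)) hvN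
      rw [hproj] at hm
      have := N.smul_of_tower_mem (((m * n : ℕ) : k) * a j)⁻¹ hm
      rw [smul_smul, inv_mul_cancel₀ (mul_ne_zero h.natCast_ne_zero ha0), one_smul] at this
      exact hlow j (by omega) this
    rw [← huv]
    simpa [h_a] using hu
  · refine le_inf (sup_le ?_ ?_) hKN
    · exact (Submodule.span_singleton_le_iff_mem _ _).2 (Submodule.smul_mem _ _ hzL)
    · exact (Submodule.span_singleton_le_iff_mem _ _).2 (Submodule.smul_mem _ _ hzL)

end GradedRel

section Lattice

variable {X : Type*} [Lattice X] [BoundedOrder X] [IsModularLattice X] {len : X → ℕ} {N : X}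

/-- If `[N, ⊤]` is complemented, `F > N` is the join of a cover of `N` and another element, with
intersection `N`. -/
theorem exists_covBy_sup_eq (hmono : StrictMono len)
    (h_c : ∀ U, N ≤ U → ∃ U', U ⊔ U' = ⊤ ∧ U ⊓ U' = N) {F : X} (hF : N < F) :
    ∃ F' S, N ≤ F' ∧ N ⋖ S ∧ F' ⊔ S = F ∧ F' ⊓ S = N := by
  obtain ⟨S, hS, hmin⟩ : ∃ S ∈ {S | N < S ∧ S ≤ F}, ∀ T ∈ {S | N < S ∧ S ≤ F}, ¬ len T < len S :=
    WellFounded.has_min (measure len).wf _ ⟨F, hF, le_rfl⟩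
  obtain ⟨T, hT, hT'⟩ := h_c S hS.1.le
  refine ⟨T ⊓ F, S, le_inf (hT' ▸ inf_le_right) hF.le, ⟨hS.1, fun U hU hUS => ?_⟩, ?_, ?_⟩
  · exact hmin U ⟨hU, hUS.le.trans hS.2⟩ (hmono hUS)
  · rw [inf_comm, inf_sup_assoc_of_le T hS.2, sup_comm T, hT, inf_top_eq]
  · rw [inf_right_comm, inf_comm T, hT', inf_eq_left.2 hF.le]

/-- Bound on the length of a semisimple bottom layer of an indecomposable module, all of whose
simple submodules modulo that layer lift to submodules of length at most three. -/
theorem length_le_of_lift (hbot : len ⊥ = 0) (hmono : StrictMono len)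
    (hadd : ∀ x y, len (x ⊔ y) + len (x ⊓ y) = len x + len y)
    (hcov : ∀ x y, x ⋖ y → len y = len x + 1)
    (hindec : ∀ x y : X, IsCompl x y → x = ⊥ ∨ y = ⊥) (hN : N ≠ ⊤)
    (hsub : ∀ U ≤ N, ∃ U', U ⊓ U' = ⊥ ∧ U ⊔ U' = N)
    (hquo : ∀ U, N ≤ U → ∃ U', U ⊔ U' = ⊤ ∧ U ⊓ U' = N)
    (hlift : ∀ S, N ⋖ S → ∃ L ≤ S, L ⊔ N = S ∧ ∃ K₁ K₂, (K₁ = ⊥ ∨ IsAtom K₁) ∧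
      (K₂ = ⊥ ∨ IsAtom K₂) ∧ L ⊓ N = K₁ ⊔ K₂)
    {s t : ℕ} (ht : len N = t) (hs : len ⊤ = s + t) : t ≤ 2 * s ∧ (s ≠ 1 → t < 2 * s) := by
  have hatom : ∀ K, (K = ⊥ ∨ IsAtom K) → len K ≤ 1 := by
    rintro K (rfl | hK)
    · omega
    · have := hcov _ _ (bot_covBy_iff.2 hK)
      omega
  have hone : ∀ S, N ⋖ S → ∃ L ≤ S, L ⊔ N = S ∧ len L ≤ 3 := by
    intro S hS
    obtain ⟨L, hL, hLN, K₁, K₂, h1, h2, hK⟩ := hlift S hS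
    refine ⟨L, hL, hLN, ?_⟩
    have e1 := hadd L N
    have e2 := hadd K₁ K₂
    have e3 := hcov _ _ hS
    have e4 := hatom _ h1
    have e5 := hatom _ h2
    rw [hLN, hK] at e1
    omega
  have hall : ∀ j F, N ≤ F → len F = len N + j → ∃ L ≤ F, L ⊔ N = F ∧ len L ≤ 3 * j := by
    intro j
    induction j with
    | zero =>
      intro F hF hj
      have : N = F := hF.eq_of_not_lt fun h => by have := hmono h; omega
      exact ⟨⊥, bot_le, by rw [bot_sup_eq, this], by omega⟩
    | succ j ih =>
      intro F hF hj
      obtain ⟨F', S, hNF', hS, hF'S, hF'S'⟩ := exists_covBy_sup_eq hmono hquo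
        (hF.lt_of_ne (by rintro rfl; omega))
      have e1 := hadd F' S
      have e2 := hcov _ _ hS
      rw [hF'S, hF'S'] at e1
      obtain ⟨L, hL, hLN, hLl⟩ := ih F' hNF' (by omega)
      obtain ⟨L₁, hL₁, hLN₁, hLl₁⟩ := hone S hS
      refine ⟨L ⊔ L₁, sup_le (hL.trans (hF'S ▸ le_sup_left)) (hL₁.trans (hF'S ▸ le_sup_right)),
        ?_, ?_⟩
      · rw [← hF'S, ← hLN, ← hLN₁, sup_sup_sup_comm, sup_idem]
      · have := hadd L L₁
        omega
  have htop : ∀ L, L ⊔ N = ⊤ → L = ⊤ := by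
    intro L hL
    obtain ⟨U, hU, hU'⟩ := hsub (L ⊓ N) inf_le_right
    have hUN : U ≤ N := hU' ▸ le_sup_right
    have h_c : IsCompl L U := by
      refine IsCompl.of_eq ?_ ?_
      · rw [← hU, inf_assoc, inf_eq_right.2 hUN]
      · rw [← hL, ← hU', ← sup_assoc, sup_inf_self]
    rcases hindec _ _ h_c with rfl | rfl
    · exact absurd (by simpa using hL) hN
    · rw [sup_bot_eq] at hU'
      rwa [sup_eq_left.2 (inf_eq_right.1 hU')] at hL
  obtain ⟨L, -, hLN, hLl⟩ := hall s ⊤ le_top (by omega)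
  have hL := htop L hLN
  rw [hL] at hLl
  refine ⟨by omega, fun hs1 => ?_⟩
  by_contra hlt
  obtain ⟨F', S, hNF', hS, hF'S, hF'S'⟩ := exists_covBy_sup_eq hmono hquo (lt_top_iff_ne_top.2 hN)
  have e1 := hadd F' S
  have e2 := hcov _ _ hS
  rw [hF'S, hF'S'] at e1
  have e4 := hmono (lt_top_iff_ne_top.2 hN)
  obtain ⟨L₂, hL₂, hLN₂, hLl₂⟩ := hall (s - 1) F' hNF' (by omega)
  obtain ⟨L₁, hL₁, hLN₁, hLl₁⟩ := hone S hS
  have h12 : L₂ ⊔ L₁ = ⊤ := htop _ (by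
    rw [← hF'S, ← hLN₂, ← hLN₁, sup_sup_sup_comm, sup_idem])
  have e3 := hadd L₂ L₁
  rw [h12] at e3
  have h0 : L₂ ⊓ L₁ = ⊥ := by
    by_contra h
    have := hmono (bot_lt_iff_ne_bot.2 h)
    omega
  rcases hindec _ _ (IsCompl.of_eq h0 h12) with rfl | rfl
  · omega
  · omega

/-- Dual form of `length_le_of_lift`. -/
theorem length_le_of_colift (hbot : len ⊥ = 0) (hmono : StrictMono len)
    (hadd : ∀ x y, len (x ⊔ y) + len (x ⊓ y) = len x + len y)
    (hcov : ∀ x y, x ⋖ y → len y = len x + 1)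
    (hindec : ∀ x y : X, IsCompl x y → x = ⊥ ∨ y = ⊥) (hN : N ≠ ⊥)
    (hsub : ∀ U ≤ N, ∃ U', U ⊓ U' = ⊥ ∧ U ⊔ U' = N)
    (hquo : ∀ U, N ≤ U → ∃ U', U ⊔ U' = ⊤ ∧ U ⊓ U' = N)
    (hlift : ∀ S, S ⋖ N → ∃ L, S ≤ L ∧ L ⊓ N = S ∧ ∃ K₁ K₂, (K₁ = ⊤ ∨ IsCoatom K₁) ∧
      (K₂ = ⊤ ∨ IsCoatom K₂) ∧ L ⊔ N = K₁ ⊓ K₂)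
    {s t : ℕ} (ht : len N = t) (hs : len ⊤ = s + t) : s ≤ 2 * t ∧ (t ≠ 1 → s < 2 * t) := by
  have hle : ∀ x, len x ≤ len ⊤ := fun x => hmono.monotone le_top
  refine length_le_of_lift (X := Xᵒᵈ) (N := OrderDual.toDual N)
    (len := fun x => len ⊤ - len (OrderDual.ofDual x)) (by simp) ?_ ?_ ?_ ?_ ?_ ?_ ?_ ?_ ?_ ?_
  · intro x y hxy
    have h1 := hmono (OrderDual.ofDual_lt_ofDual.2 hxy)
    have h2 := hle (OrderDual.ofDual x)
    simp only
    omega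
  · intro x y
    have h1 := hadd (OrderDual.ofDual x) (OrderDual.ofDual y)
    have h2 := hle (OrderDual.ofDual x)
    have h3 := hle (OrderDual.ofDual y)
    have h4 := hle (OrderDual.ofDual x ⊔ OrderDual.ofDual y)
    have h5 := hle (OrderDual.ofDual x ⊓ OrderDual.ofDual y)
    simp only [ofDual_sup, ofDual_inf]
    omega
  · intro x y hxy
    have h1 := hcov _ _ hxy.ofDual
    have h2 := hle (OrderDual.ofDual x)
    omega
  · intro x y hxy
    have h := hxy.ofDual
    rcases hindec _ _ h.symm with h1 | h1
    · refine Or.inl (OrderDual.ofDual.injective ?_)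
      rw [h1] at h
      simpa using h.sup_eq_top
    · refine Or.inr (OrderDual.ofDual.injective ?_)
      rw [h1] at h
      simpa using h.sup_eq_top
  · exact fun h => hN (OrderDual.toDual.injective h)
  · intro U hU
    exact hquo (OrderDual.ofDual U) hU
  · intro U hU
    exact hsub (OrderDual.ofDual U) hU
  · intro S hS
    obtain ⟨L, h1, h2, K₁, K₂, h3, h4, h5⟩ := hlift (OrderDual.ofDual S) hS.ofDual
    exact ⟨OrderDual.toDual L, h1, h2, OrderDual.toDual K₁, OrderDual.toDual K₂,
      h3.imp id fun h => h.dual, h4.imp id fun h => h.dual, h5⟩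
  · simp only [OrderDual.ofDual_toDual]
    have : len ⊤ - len N = s := by omega
    exact this
  · simp only [OrderDual.ofDual_top, hbot]
    omega

end Lattice

section Dual

variable {k R V : Type*} [Field k] [Ring R] [Algebra k R] [AddCommGroup V] [Module k V]
  [Module R V] [IsScalarTower k R V]

/-- The dual of a left `R`-module as a left `Rᵐᵒᵖ`-module. -/
@[reducible] def dualModule : Module Rᵐᵒᵖ (Module.Dual k V) where
  smul r f := f ∘ₗ Algebra.lsmul k k V r.unop
  one_smul f := by ext v; exact congrArg f (one_smul R v)
  mul_smul r s f := by ext v; exact congrArg f (mul_smul s.unop r.unop v)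
  smul_zero r := rfl
  smul_add r f g := rfl
  add_smul r s f := by
    ext v
    exact (congrArg f (add_smul r.unop s.unop v)).trans (map_add f _ _)
  zero_smul f := by ext v; exact (congrArg f (zero_smul R v)).trans (map_zero f)

attribute [local instance] dualModule

theorem dualModule_smul_apply (r : Rᵐᵒᵖ) (f : Module.Dual k V) (v : V) :
    (r • f) v = f (r.unop • v) := rfl

theorem dualModule_isScalarTower : IsScalarTower k Rᵐᵒᵖ (Module.Dual k V) where
  smul_assoc c r f := by
    ext v
    rw [dualModule_smul_apply, LinearMap.smul_apply, dualModule_smul_apply, MulOpposite.unop_smul,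
      smul_assoc, map_smul]

attribute [local instance] dualModule_isScalarTower

/-- The annihilator gives an antitone correspondence between the submodules of a module and those
of its dual. -/
def submoduleDualIso [FiniteDimensional k V] :
    Submodule R V ≃o (Submodule Rᵐᵒᵖ (Module.Dual k V))ᵒᵈ where
  toFun W := OrderDual.toDual
    { (W.restrictScalars k).dualAnnihilator with
      smul_mem' := fun r f hf => (Submodule.mem_dualAnnihilator _).2 fun w hw =>
        (Submodule.mem_dualAnnihilator _).1 hf _ (W.smul_mem r.unop hw) }
  invFun W :=
    { (Submodule.restrictScalars k (OrderDual.ofDual W)).dualCoannihilator with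
      smul_mem' := fun r v hv => (Submodule.mem_dualCoannihilator _).2 fun f hf =>
        (Submodule.mem_dualCoannihilator _).1 hv _
          ((OrderDual.ofDual W).smul_mem (MulOpposite.op r) hf) }
  left_inv W := by
    ext v
    exact SetLike.ext_iff.1
      (Subspace.dualAnnihilator_dualCoannihilator_eq (W := W.restrictScalars k)) v
  right_inv W := by
    refine OrderDual.ofDual.injective ?_
    ext f
    exact SetLike.ext_iff.1
      (Subspace.dualCoannihilator_dualAnnihilator_eq (W := (OrderDual.ofDual W).restrictScalars k)) f
  map_rel_iff' {W W'} := Subspace.dualAnnihilator_le_dualAnnihilator_iff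
    (W := W'.restrictScalars k) (W' := W.restrictScalars k)

/-- Dual form of `GradedRel.exists_lift`. -/
theorem GradedRel.exists_colift [FiniteDimensional k V] {m n : ℕ} {ξ ε : k} {A B C D : R}
    (h : GradedRel m n ξ ε A B C D)
    {N S : Submodule R V} (hN : ∀ U, N ≤ U → ∃ U', U ⊔ U' = ⊤ ∧ U ⊓ U' = N) (hSN : S ⋖ N) :
    ∃ L, S ≤ L ∧ L ⊓ N = S ∧ ∃ K₁ K₂ : Submodule R V, (K₁ = ⊤ ∨ IsCoatom K₁) ∧
      (K₂ = ⊤ ∨ IsCoatom K₂) ∧ L ⊔ N = K₁ ⊓ K₂ := by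
  have : IsArtinian Rᵐᵒᵖ (Module.Dual k V) := isArtinian_of_tower k inferInstance
  let e : (Submodule R V)ᵒᵈ ≃o Submodule Rᵐᵒᵖ (Module.Dual k V) := submoduleDualIso.dual.trans
    (OrderIso.dualDual _).symm
  have hcov : e (OrderDual.toDual N) ⋖ e (OrderDual.toDual S) :=
    (apply_covBy_apply_iff e).2 hSN.toDual
  have hN' : ∀ U ≤ e (OrderDual.toDual N), ∃ U', U ⊓ U' = ⊥ ∧ U ⊔ U' = e (OrderDual.toDual N) := by
    intro U hU
    obtain ⟨U, rfl⟩ := e.surjective U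
    rw [e.le_iff_le] at hU
    obtain ⟨U', h1, h2⟩ := hN U.ofDual hU
    refine ⟨e (OrderDual.toDual U'), ?_, ?_⟩
    · rw [← e.map_inf, map_eq_bot_iff]
      exact h1
    · rw [← e.map_sup, e.injective.eq_iff]
      exact h2
  obtain ⟨L, hL, hLN, K₁, K₂, h1, h2, hK⟩ := h.op.exists_lift (V := Module.Dual k V)
    (N := e (OrderDual.toDual N)) (S := e (OrderDual.toDual S)) hN' hcov
  obtain ⟨L, rfl⟩ := e.surjective L
  obtain ⟨K₁, rfl⟩ := e.surjective K₁
  obtain ⟨K₂, rfl⟩ := e.surjective K₂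
  rw [e.le_iff_le] at hL
  rw [← e.map_sup, e.injective.eq_iff] at hLN
  rw [← e.map_sup, ← e.map_inf, e.injective.eq_iff] at hK
  rw [e.isAtom_iff, map_eq_bot_iff] at h1 h2
  exact ⟨L.ofDual, hL, hLN, K₁.ofDual, K₂.ofDual,
    h1.imp id isAtom_dual_iff_isCoatom.1, h2.imp id isAtom_dual_iff_isCoatom.1, hK⟩

end Dual

section Double

theorem mul_pow_of_smul_comm {k R : Type*} [Field k] [Ring R] [Algebra k R] {X Y : R} {ζ : k}
    (h : Y * X = ζ • (X * Y)) (i : ℕ) : Y * X ^ i = ζ ^ i • (X ^ i * Y) := by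
  induction i with
  | zero => simp
  | succ i ih => rw [pow_succ, ← mul_assoc, ih, smul_mul_assoc, mul_assoc, h, mul_smul_comm,
      smul_smul, ← mul_assoc, pow_succ]

theorem pow_mul_of_smul_comm {k R : Type*} [Field k] [Ring R] [Algebra k R] {X Y : R} {ζ : k}
    (h : Y * X = ζ • (X * Y)) (i : ℕ) : Y ^ i * X = ζ ^ i • (X * Y ^ i) := by
  induction i with
  | zero => simp
  | succ i ih => rw [pow_succ', mul_assoc, ih, mul_smul_comm, ← mul_assoc, h, smul_mul_assoc,
      smul_smul, mul_assoc, pow_succ]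

/-- The defining relations of `H_{mn}(ξ)`, with `1 / (n-1)!_q` replaced by any scalar `μ`. -/
structure DoubleRel {k R : Type*} [Field k] [Ring R] [Algebra k R] (m n : ℕ) (ξ μ : k)
    (a b c d : R) : Prop where
  prim : IsPrimitiveRoot ξ (m * n)
  one_lt : 1 < m
  pos : 0 < n
  a_pow : a ^ n = b ^ n - 1
  b_pow : b ^ (m * n) = 1
  c_pow : c ^ (m * n) = 1
  d_pow : d ^ n = 0
  ab : a * b = ξ ^ m • (b * a)
  dc : d * c = ξ • (c * d)
  bc : b * c = c * b
  bd : b * d = ξ ^ m • (d * b)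
  ad : a * d - d * a = b - c ^ m
  ac : a * c = ξ⁻¹ • (c * a) +
    ((ξ⁻¹ - ξ ^ (n - 1)) * μ) • ((c ^ (m + 1) - ξ ^ m • (b * c)) * d ^ (n - 1))
  gen : Algebra.adjoin k {a, b, c, d} = ⊤

variable {k R : Type*} [Field k] [Ring R] [Algebra k R] {m n : ℕ} {ξ μ : k} {a b c d : R}

theorem d_mul_b (h0 : ξ ≠ 0) (hbd : b * d = ξ ^ m • (d * b)) : d * b = (ξ ^ m)⁻¹ • (b * d) := by
  rw [hbd, smul_smul, inv_mul_cancel₀ (pow_ne_zero _ h0), one_smul]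

/-- Moving `A` to the left past powers of `d`. -/
theorem pow_succ_mul_eq {A : R} {ε : k} (h0 : ξ ≠ 0) (hdc : d * c = ξ • (c * d))
    (hbd : b * d = ξ ^ m • (d * b)) (had : A * d - d * A = ε • (b - c ^ m)) (j : ℕ) :
    ∃ s t : k, d ^ (j + 1) * A = A * d ^ (j + 1) + (s • b + t • c ^ m) * d ^ j := by
  induction j with
  | zero =>
    refine ⟨-ε, ε, ?_⟩
    have : d * A = A * d - ε • (b - c ^ m) := by rw [← had]; abel
    simp only [zero_add, pow_one, pow_zero, mul_one, this, smul_sub, neg_smul]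
    abel
  | succ j ih =>
    obtain ⟨s, t, ih⟩ := ih
    have : d * A = A * d - ε • (b - c ^ m) := by rw [← had]; abel
    refine ⟨s * (ξ ^ m)⁻¹ - ε, t * ξ ^ m + ε, ?_⟩
    rw [pow_succ', mul_assoc, ih, mul_add, ← mul_assoc, ← mul_assoc, this, mul_add d, mul_smul_comm,
      mul_smul_comm, d_mul_b h0 hbd, mul_pow_of_smul_comm hdc, pow_succ' d j]
    simp only [smul_sub, sub_mul, add_mul, add_smul, sub_smul, smul_mul_assoc, smul_smul, mul_assoc]
    abel

namespace DoubleRel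

/-- The correction term making `a` homogeneous for conjugation by `c`. -/
def corr (m n : ℕ) (ξ μ : k) (b c d : R) : R := μ • ((c ^ m - ξ ^ m • b) * d ^ (n - 1))

theorem xi_ne_zero (h : DoubleRel m n ξ μ a b c d) : ξ ≠ 0 :=
  h.prim.ne_zero (Nat.mul_pos (by have := h.one_lt; omega) h.pos).ne'

theorem d_mul_d_pow (h : DoubleRel m n ξ μ a b c d) : d * d ^ (n - 1) = 0 := by
  rw [← pow_succ', Nat.sub_add_cancel h.pos, h.d_pow]

theorem xi_pow_pred (h : DoubleRel m n ξ μ a b c d) : ((ξ ^ m)⁻¹) ^ (n - 1) = ξ ^ m := by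
  have h1 : (ξ ^ m) ^ n = 1 := by rw [← pow_mul, h.prim.pow_eq_one]
  rw [inv_pow, inv_eq_iff_eq_inv]
  exact eq_inv_of_mul_eq_one_left (by rw [← pow_succ, Nat.sub_add_cancel h.pos, h1])

theorem corr_mul_d (h : DoubleRel m n ξ μ a b c d) : corr m n ξ μ b c d * d = 0 := by
  rw [corr, smul_mul_assoc, mul_assoc, ← pow_succ, Nat.sub_add_cancel h.pos, h.d_pow, mul_zero,
    smul_zero]

theorem d_mul_corr (h : DoubleRel m n ξ μ a b c d) : d * corr m n ξ μ b c d = 0 := by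
  rw [corr, mul_smul_comm, ← mul_assoc, mul_sub, mul_pow_of_smul_comm h.dc, mul_smul_comm,
    d_mul_b h.xi_ne_zero h.bd, sub_mul, smul_mul_assoc, smul_mul_assoc, smul_mul_assoc, mul_assoc,
    mul_assoc, h.d_mul_d_pow]
  simp

theorem d_pow_mul_b (h : DoubleRel m n ξ μ a b c d) :
    d ^ (n - 1) * b = ξ ^ m • (b * d ^ (n - 1)) := by
  rw [pow_mul_of_smul_comm (d_mul_b h.xi_ne_zero h.bd), h.xi_pow_pred]

theorem corr_mul_b (h : DoubleRel m n ξ μ a b c d) :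
    corr m n ξ μ b c d * b = ξ ^ m • (b * corr m n ξ μ b c d) := by
  have hbc : b * c ^ m = c ^ m * b := (Commute.pow_right h.bc m).eq
  rw [corr, smul_mul_assoc, mul_assoc, h.d_pow_mul_b]
  simp only [mul_smul_comm, smul_mul_assoc, sub_mul, mul_sub, ← mul_assoc, hbc]
  rw [smul_comm]

theorem corr_mul_c (h : DoubleRel m n ξ μ a b c d) :
    corr m n ξ μ b c d * c = ξ ^ (n - 1) • (c * corr m n ξ μ b c d) := by
  have hcc : c * c ^ m = c ^ m * c := (Commute.pow_right (Commute.refl c) m).eq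
  rw [corr, smul_mul_assoc, mul_assoc, pow_mul_of_smul_comm h.dc]
  simp only [mul_smul_comm, smul_mul_assoc, sub_mul, mul_sub, ← mul_assoc, hcc, h.bc]
  rw [smul_comm]

theorem add_corr_mul_b (h : DoubleRel m n ξ μ a b c d) :
    (a + corr m n ξ μ b c d) * b = ξ ^ m • (b * (a + corr m n ξ μ b c d)) := by
  rw [add_mul, h.ab, h.corr_mul_b, mul_add, smul_add]

theorem c_mul_add_corr (h : DoubleRel m n ξ μ a b c d) :
    c * (a + corr m n ξ μ b c d) = ξ • ((a + corr m n ξ μ b c d) * c) := by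
  have hcc : c ^ (m + 1) - ξ ^ m • (b * c) = c * (c ^ m - ξ ^ m • b) := by
    rw [mul_sub, mul_smul_comm, h.bc, pow_succ']
  have hac : a * c = ξ⁻¹ • (c * a) + (ξ⁻¹ - ξ ^ (n - 1)) • (c * corr m n ξ μ b c d) := by
    rw [h.ac, hcc, corr, mul_smul_comm, smul_smul, mul_assoc]
  rw [add_mul, hac, h.corr_mul_c, sub_smul, add_assoc, sub_add_cancel, ← smul_add, smul_smul,
    mul_inv_cancel₀ h.xi_ne_zero, one_smul, mul_add]

theorem add_corr_mul_d (h : DoubleRel m n ξ μ a b c d) :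
    (a + corr m n ξ μ b c d) * d - d * (a + corr m n ξ μ b c d) = (1 : k) • (b - c ^ m) := by
  rw [add_mul, mul_add, h.corr_mul_d, h.d_mul_corr, add_zero, add_zero, h.ad, one_smul]

theorem d_pow_mul_pow_mul (h : DoubleRel m n ξ μ a b c d) (i : ℕ) : ∀ j, i < j →
    d ^ j * (a + corr m n ξ μ b c d) ^ i * d ^ (n - 1) = 0 := by
  induction i with
  | zero =>
    intro j hj
    obtain ⟨j, rfl⟩ := Nat.exists_eq_succ_of_ne_zero hj.ne'
    rw [pow_zero, mul_one, pow_succ, mul_assoc, h.d_mul_d_pow, mul_zero]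
  | succ i ih =>
    intro j hj
    obtain ⟨j, rfl⟩ := Nat.exists_eq_succ_of_ne_zero (Nat.ne_of_gt (Nat.zero_lt_of_lt hj))
    obtain ⟨s, t, hst⟩ := pow_succ_mul_eq h.xi_ne_zero h.dc h.bd h.add_corr_mul_d j
    rw [pow_succ' (a + _), ← mul_assoc, Nat.succ_eq_add_one, hst, add_mul, add_mul]
    rw [mul_assoc, mul_assoc, mul_assoc, mul_assoc, ← mul_assoc (d ^ (j + 1)),
      ← mul_assoc (d ^ j), ih (j + 1) (by omega), ih j (by omega), mul_zero, mul_zero, add_zero]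

theorem corr_mul_pow_mul_corr (h : DoubleRel m n ξ μ a b c d) {i : ℕ} (hi : i + 1 < n) :
    corr m n ξ μ b c d * (a + corr m n ξ μ b c d) ^ i * corr m n ξ μ b c d = 0 := by
  obtain ⟨x, hx⟩ : ∃ x, corr m n ξ μ b c d = d ^ (n - 1) * x := by
    have h1 : ξ ^ m ≠ 0 := pow_ne_zero _ h.xi_ne_zero
    refine ⟨μ • ((((ξ ^ (n - 1)) ^ m)⁻¹) • c ^ m - b), ?_⟩
    rw [corr, mul_smul_comm, mul_sub, h.d_pow_mul_b, mul_smul_comm,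
      mul_pow_of_smul_comm (pow_mul_of_smul_comm h.dc (n - 1)), smul_smul, inv_mul_cancel₀
      (pow_ne_zero _ (pow_ne_zero _ h.xi_ne_zero)), one_smul, sub_mul, smul_mul_assoc]
  have h0 : d ^ (n - 1) * ((a + corr m n ξ μ b c d) ^ i * (d ^ (n - 1) * x)) = 0 := by
    simpa only [mul_assoc, zero_mul] using
      congrArg (· * x) (h.d_pow_mul_pow_mul i (n - 1) (by omega))
  nth_rw 3 [hx]
  nth_rw 1 [corr]
  rw [smul_mul_assoc, smul_mul_assoc, mul_assoc, mul_assoc, h0, mul_zero, smul_zero]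

theorem add_corr_pow (h : DoubleRel m n ξ μ a b c d) : (a + corr m n ξ μ b c d) ^ n = 0 := by
  set G := corr m n ξ μ b c d with hG
  set A := a + G with hA
  have haA : a = A - G := by rw [hA, add_sub_cancel_right]
  have hcG : ξ ^ n • (c * G) = ξ • (G * c) := by
    rw [h.corr_mul_c, smul_smul, ← pow_succ', Nat.sub_add_cancel h.pos]
  have key : ∀ l, l ≤ n → ∃ E, a ^ l = A ^ l - E ∧ ξ ^ n • (c * E) = ξ ^ l • (E * c) ∧
      ∀ i, i + l < n → G * A ^ i * E = 0 := by
    intro l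
    induction l with
    | zero => exact fun _ => ⟨0, by simp, by simp, by simp⟩
    | succ l ih =>
      intro hl
      obtain ⟨E, h1, h2, h3⟩ := ih (by omega)
      refine ⟨A * E + G * A ^ l, ?_, ?_, ?_⟩
      · have h4 : G * E = 0 := by simpa using h3 0 (by omega)
        rw [pow_succ', h1, haA, sub_mul, mul_sub, mul_sub, h4, sub_zero, ← pow_succ', sub_sub]
      · have h4 : c * A ^ l = ξ ^ l • (A ^ l * c) := mul_pow_of_smul_comm h.c_mul_add_corr l
        have h5 : c * (A * E) = ξ • (A * (c * E)) := by
          rw [← mul_assoc, h.c_mul_add_corr, smul_mul_assoc, mul_assoc]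
        have h6 : ξ ^ n • (c * (A * E)) = ξ ^ (l + 1) • (A * E * c) := by
          rw [h5, smul_comm, ← mul_smul_comm, h2, mul_smul_comm, smul_smul, ← pow_succ', mul_assoc]
        have h7 : ξ ^ n • (c * (G * A ^ l)) = ξ ^ (l + 1) • (G * A ^ l * c) := by
          rw [← mul_assoc c, ← smul_mul_assoc, hcG, smul_mul_assoc, mul_assoc G, h4, mul_smul_comm,
            smul_smul, ← pow_succ', mul_assoc]
        rw [mul_add c (A * E), smul_add, add_mul (A * E), smul_add, h6, h7]
      · intro i hi
        rw [mul_add, mul_assoc, ← mul_assoc (A ^ i), ← pow_succ, ← mul_assoc, h3 (i + 1) (by omega),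
          ← mul_assoc, h.corr_mul_pow_mul_corr (by omega), zero_mul, add_zero]
  obtain ⟨E, h1, h2, -⟩ := key n le_rfl
  have h0 : ξ ^ n ≠ 0 := pow_ne_zero _ h.xi_ne_zero
  have h2 : c * E = E * c := smul_right_injective R h0 h2
  have h3 : A ^ n = b ^ n - 1 + E := by rw [← h.a_pow, h1, sub_add_cancel]
  have h4 : c * A ^ n = A ^ n * c := by
    rw [h3, mul_add, add_mul, h2, mul_sub, sub_mul, mul_one, one_mul,
      (Commute.pow_left h.bc n).eq]
  have h5 : c * A ^ n = ξ ^ n • (A ^ n * c) := mul_pow_of_smul_comm h.c_mul_add_corr n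
  have h6 : (ξ ^ n - 1) • (A ^ n * c) = 0 := by rw [sub_smul, one_smul, ← h5, h4, sub_self]
  have h7 : ξ ^ n - 1 ≠ 0 := sub_ne_zero.2 (h.prim.pow_ne_one_of_pos_of_lt h.pos.ne'
    (by have := h.one_lt; have := h.pos; nlinarith))
  have h8 : A ^ n * c = 0 := (smul_eq_zero.1 h6).resolve_left h7
  have hmn : m * n = m * n - 1 + 1 :=
    (Nat.sub_add_cancel (Nat.mul_pos (by have := h.one_lt; omega) h.pos)).symm
  rw [← mul_one (A ^ n), ← h.c_pow, hmn, pow_succ', ← mul_assoc, h8, zero_mul]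

theorem gradedRel (h : DoubleRel m n ξ μ a b c d) :
    GradedRel m n ξ 1 (a + corr m n ξ μ b c d) b c d where
  prim := h.prim
  one_lt := h.one_lt
  pos := h.pos
  A_pow := h.add_corr_pow
  D_pow := h.d_pow
  B_pow := h.b_pow
  C_pow := h.c_pow
  AB := h.add_corr_mul_b
  DC := h.dc
  BC := h.bc
  BD := h.bd
  CA := h.c_mul_add_corr
  AD := h.add_corr_mul_d
  gen := by
    set S := Algebra.adjoin k {a + corr m n ξ μ b c d, b, c, d} with hS
    have h_b : b ∈ S := Algebra.subset_adjoin (by simp)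
    have h_c : c ∈ S := Algebra.subset_adjoin (by simp)
    have h_d : d ∈ S := Algebra.subset_adjoin (by simp)
    have h_a : a ∈ S := by
      have h1 : a + corr m n ξ μ b c d ∈ S := Algebra.subset_adjoin (by simp)
      have h2 : corr m n ξ μ b c d ∈ S :=
        S.smul_mem (mul_mem (sub_mem (pow_mem h_c _) (S.smul_mem h_b _)) (pow_mem h_d _)) _
      simpa using sub_mem h1 h2
    rw [eq_top_iff, ← h.gen, Algebra.adjoin_le_iff]
    rintro x (rfl | rfl | rfl | rfl) <;> assumption

end DoubleRel

namespace GradedRel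

theorem finite {ε : k} {A B C D : R} (h : GradedRel m n ξ ε A B C D) : Module.Finite k R := by
  have h0 := h.xi_ne_zero
  set p : Submodule k R := Submodule.span k (Set.range fun x : Fin (m * n) × Fin (m * n) ×
    Fin n × Fin n => C ^ (x.1 : ℕ) * (B ^ (x.2.1 : ℕ) * (D ^ (x.2.2.1 : ℕ) * A ^ (x.2.2.2 : ℕ))))
    with hp
  have hmn : 0 < m * n := Nat.mul_pos (by have := h.one_lt; omega) h.pos
  have hmem : ∀ i j s t : ℕ, C ^ i * (B ^ j * (D ^ s * A ^ t)) ∈ p := by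
    intro i j s t
    rcases le_or_gt n s with hs | hs
    · rw [pow_eq_zero_of_le hs h.D_pow]; simp
    rcases le_or_gt n t with ht | ht
    · rw [pow_eq_zero_of_le ht h.A_pow]; simp
    rw [pow_eq_pow_mod i h.C_pow, pow_eq_pow_mod j h.B_pow]
    exact Submodule.subset_span ⟨(⟨_, Nat.mod_lt _ hmn⟩, ⟨_, Nat.mod_lt _ hmn⟩, ⟨s, hs⟩, ⟨t, ht⟩),
      rfl⟩
  have hext : ∀ Y : R, (∀ i j s t : ℕ, Y * (C ^ i * (B ^ j * (D ^ s * A ^ t))) ∈ p) →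
      ∀ x ∈ p, Y • x ∈ p := by
    intro Y hY x hx
    induction hx using Submodule.span_induction with
    | mem x hx => obtain ⟨x, rfl⟩ := hx; exact hY _ _ _ _
    | zero => rw [smul_zero]; exact zero_mem _
    | add x y _ _ hx hy => rw [smul_add]; exact add_mem hx hy
    | smul c x _ hx => rw [smul_comm]; exact p.smul_mem c hx
  have hAC : A * C = ξ⁻¹ • (C * A) := by rw [h.CA, smul_smul, inv_mul_cancel₀ h0, one_smul]
  have hcomm : ∀ {Y : R} {u v : k}, Y * C = u • (C * Y) → Y * B = v • (B * Y) → ∀ i j (z : R),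
      Y * (C ^ i * (B ^ j * z)) = (u ^ i * v ^ j) • (C ^ i * (B ^ j * (Y * z))) := by
    intro Y u v hu hv i j z
    rw [← mul_assoc, mul_pow_of_smul_comm hu, smul_mul_assoc, mul_assoc, ← mul_assoc Y,
      mul_pow_of_smul_comm hv, smul_mul_assoc, mul_smul_comm, smul_smul, mul_assoc]
  have htop : ∀ r : R, r ∈ p := by
    intro r
    have h1 : (1 : R) ∈ p := by simpa using hmem 0 0 0 0
    have := h.smul_mem_of_invariant p (hext A ?_) (hext B ?_) (hext C ?_) (hext D ?_) r 1 h1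
    · simpa using this
    · intro i j s t
      rw [hcomm hAC h.AB]
      refine p.smul_mem _ ?_
      cases s with
      | zero => rw [pow_zero, one_mul, ← pow_succ']; simpa using hmem i j 0 (t + 1)
      | succ s =>
        obtain ⟨u, v, huv⟩ := pow_succ_mul_eq h0 h.DC h.BD h.AD s
        have h2 : A * D ^ (s + 1) = D ^ (s + 1) * A - (u • B + v • C ^ m) * D ^ s := by
          rw [huv, add_sub_cancel_right]
        have h3 : C ^ i * (B ^ j * (A * (D ^ (s + 1) * A ^ t))) =
            C ^ i * (B ^ j * (D ^ (s + 1) * A ^ (t + 1))) -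
            (u • (C ^ i * (B ^ (j + 1) * (D ^ s * A ^ t))) +
              v • (C ^ (i + m) * (B ^ j * (D ^ s * A ^ t)))) := by
          have h4 : B ^ j * C ^ m = C ^ m * B ^ j := (Commute.pow_pow h.BC j m).eq
          rw [← mul_assoc A, h2, sub_mul, mul_sub, mul_sub, mul_assoc, ← pow_succ', add_mul,
            add_mul, mul_add, mul_add]
          congr 2
          · simp only [smul_mul_assoc, mul_smul_comm, pow_succ, mul_assoc]
          · simp only [smul_mul_assoc, mul_smul_comm, pow_add, mul_assoc]
            rw [← mul_assoc (B ^ j), h4, mul_assoc]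
        rw [h3]
        exact sub_mem (hmem _ _ _ _) (add_mem (p.smul_mem _ (hmem _ _ _ _))
          (p.smul_mem _ (hmem _ _ _ _)))
    · intro i j s t
      rw [← mul_assoc, (Commute.pow_right h.BC i).eq, mul_assoc, ← mul_assoc B, ← pow_succ']
      exact hmem _ _ _ _
    · intro i j s t
      rw [← mul_assoc, ← pow_succ']
      exact hmem _ _ _ _
    · intro i j s t
      rw [hcomm h.DC (d_mul_b h0 h.BD), ← mul_assoc D, ← pow_succ']
      exact p.smul_mem _ (hmem _ _ _ _)
  exact ⟨⟨Set.finite_range _ |>.toFinset, by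
    rw [Set.Finite.coe_toFinset, eq_top_iff]; exact fun r _ => htop r⟩⟩

end GradedRel

end Double

section Length

variable {R V : Type*} [Ring R] [AddCommGroup V] [Module R V]

theorem isSemisimpleModule_of_jacobson_smul [IsSemiprimaryRing R]
    (h : ∀ r ∈ Ring.jacobson R, ∀ x : V, r • x = 0) : IsSemisimpleModule R V := by
  have ht : Module.IsTorsionBySet R V (Ring.jacobson R) := fun x r => h r r.2 x
  have := IsSemiprimaryRing.isSemisimpleRing (R := R)
  let _ := ht.module
  exact (ht.semilinearMap.isSemisimpleModule_iff_of_bijective Function.bijective_id).2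
    inferInstance

theorem exists_compl_of_isSemisimpleModule {N : Submodule R V} [IsSemisimpleModule R N]
    (U : Submodule R V) (hU : U ≤ N) : ∃ U', U ⊓ U' = ⊥ ∧ U ⊔ U' = N := by
  have : ComplementedLattice (Set.Iic N) := N.mapIic.complementedLattice_iff.1 inferInstance
  obtain ⟨U', h⟩ := exists_isCompl (⟨U, hU⟩ : Set.Iic N)
  exact ⟨U', congrArg Subtype.val h.inf_eq_bot, congrArg Subtype.val h.sup_eq_top⟩

theorem exists_compl_of_isSemisimpleModule_quotient {N : Submodule R V}
    [IsSemisimpleModule R (V ⧸ N)] (U : Submodule R V) (hU : N ≤ U) :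
    ∃ U', U ⊔ U' = ⊤ ∧ U ⊓ U' = N := by
  have : ComplementedLattice (Set.Ici N) :=
    (Submodule.comapMkQRelIso N).complementedLattice_iff.1 inferInstance
  obtain ⟨U', h⟩ := exists_isCompl (⟨U, hU⟩ : Set.Ici N)
  exact ⟨U', congrArg Subtype.val h.sup_eq_top, congrArg Subtype.val h.inf_eq_bot⟩

theorem length_eq_length_add_length_quotient (N : Submodule R V) :
    Module.length R V = Module.length R N + Module.length R (V ⧸ N) :=
  Module.length_eq_add_of_exact N.subtype N.mkQ N.subtype_injective N.mkQ_surjective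
    (LinearMap.exact_subtype_mkQ N)

theorem length_eq_length_add_of_le {N S : Submodule R V} (h : N ≤ S) :
    Module.length R S = Module.length R N + Module.length R (S ⧸ N.comap S.subtype) := by
  rw [length_eq_length_add_length_quotient (N.comap S.subtype),
    (Submodule.comapSubtypeEquivOfLe h).length_eq]

theorem length_sup_add_length_inf (N S : Submodule R V) :
    Module.length R ↥(N ⊔ S) + Module.length R ↥(N ⊓ S) =
      Module.length R N + Module.length R S := by
  rw [length_eq_length_add_of_le (le_sup_right : S ≤ N ⊔ S),
    length_eq_length_add_of_le (inf_le_left : N ⊓ S ≤ N), Submodule.comap_inf,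
    (LinearMap.quotientInfEquivSupQuotient N S).length_eq]
  ring

/-- Bounds on the lengths of the two layers of an indecomposable module of Loewy length two. -/
theorem GradedRel.length_bounds {k : Type*} [Field k] [Algebra k R] [Module k V]
    [IsScalarTower k R V] [FiniteDimensional k V] {m n : ℕ} {ξ ε : k} {A B C D : R}
    (h : GradedRel m n ξ ε A B C D) {N : Submodule R V} [IsSemisimpleModule R N]
    [IsSemisimpleModule R (V ⧸ N)]
    (hindec : ∀ x y : Submodule R V, IsCompl x y → x = ⊥ ∨ y = ⊥) (hbot : N ≠ ⊥) (htop : N ≠ ⊤)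
    {s t : ℕ} (ht : t = Module.length R N) (hs : s = Module.length R (V ⧸ N)) :
    (t ≤ 2 * s ∧ (s ≠ 1 → t < 2 * s)) ∧ s ≤ 2 * t ∧ (t ≠ 1 → s < 2 * t) := by
  have : IsArtinian R V := isArtinian_of_tower k inferInstance
  have : IsNoetherian R V := isNoetherian_of_tower k inferInstance
  obtain ⟨len, hlen⟩ : ∃ len : Submodule R V → ℕ, ∀ x, (len x : ℕ∞) = Module.length R x :=
    ⟨fun x => (Module.length R x).toNat, fun x => ENat.natCast_toNat Module.length_ne_top⟩
  have h0 : len ⊥ = 0 := by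
    have := hlen ⊥
    rw [Module.length_bot] at this
    exact_mod_cast this
  have hmono : StrictMono len := fun x y hxy => by
    have := Submodule.height_strictMono hxy
    rw [← Module.length_submodule, ← Module.length_submodule, ← hlen, ← hlen] at this
    exact_mod_cast this
  have hadd : ∀ x y, len (x ⊔ y) + len (x ⊓ y) = len x + len y := fun x y => by
    have := length_sup_add_length_inf x y
    rw [← hlen, ← hlen, ← hlen, ← hlen] at this
    exact_mod_cast this
  have hcov : ∀ x y, x ⋖ y → len y = len x + 1 := fun x y hxy => by
    have h1 := (covBy_iff_quot_is_simple hxy.le).1 hxy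
    have := length_eq_length_add_of_le hxy.le
    rw [← hlen, ← hlen, Module.length_eq_one] at this
    exact_mod_cast this
  have ht' : len N = t := by
    rw [← hlen] at ht
    exact_mod_cast ht.symm
  have hs' : len ⊤ = s + t := by
    have := length_eq_length_add_length_quotient N
    rw [← Module.length_top, ← hlen, ← hs, ← ht, add_comm] at this
    exact_mod_cast this
  have hsub : ∀ U ≤ N, ∃ U', U ⊓ U' = ⊥ ∧ U ⊔ U' = N := exists_compl_of_isSemisimpleModule
  have hquo : ∀ U, N ≤ U → ∃ U', U ⊔ U' = ⊤ ∧ U ⊓ U' = N :=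
    exists_compl_of_isSemisimpleModule_quotient
  exact ⟨length_le_of_lift h0 hmono hadd hcov hindec htop hsub hquo
      (fun S hS => h.exists_lift hsub hS) ht' hs',
    length_le_of_colift h0 hmono hadd hcov hindec hbot hsub hquo
      (fun S hS => h.exists_colift hquo hS) ht' hs'⟩

end Length

section Presentation

theorem doubleRel_gen {𝕜 : Type} [Field 𝕜] {m n : ℕ} {ξ : 𝕜} (hm : 1 < m) (hn : 1 < n)
    (hξ : IsPrimitiveRoot ξ (m * n)) :
    DoubleRel m n ξ (qFact 𝕜 (ξ ^ m) (n - 1))⁻¹ (gen 𝕜 m n ξ 0) (gen 𝕜 m n ξ 1) (gen 𝕜 m n ξ 2)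
      (gen 𝕜 m n ξ 3) := by
  let π : FreeAlgebra 𝕜 (Fin 4) →ₐ[𝕜] H 𝕜 m n ξ := RingQuot.mkAlgHom 𝕜 (HRel 𝕜 m n ξ)
  have hπ : ∀ {x y}, HRel 𝕜 m n ξ x y → π x = π y := fun h => RingQuot.mkAlgHom_rel 𝕜 h
  have hg : ∀ i, π (fgen 𝕜 i) = gen 𝕜 m n ξ i := fun _ => rfl
  refine ⟨hξ, hm, by omega, ?_, ?_, ?_, ?_, ?_, ?_, ?_, ?_, ?_, ?_, ?_⟩
  · simpa only [map_pow, map_sub, map_one, hg] using hπ HRel.aPow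
  · simpa only [map_pow, map_one, hg] using hπ HRel.bPow
  · simpa only [map_pow, map_one, hg] using hπ HRel.cPow
  · simpa only [map_pow, map_zero, hg] using hπ HRel.dPow
  · simpa only [map_mul, map_smul, hg] using hπ HRel.ab
  · simpa only [map_mul, map_smul, hg] using hπ HRel.dc
  · simpa only [map_mul, hg] using hπ HRel.bc
  · simpa only [map_mul, map_smul, hg] using hπ HRel.bd
  · simpa only [map_mul, map_sub, map_pow, hg] using hπ HRel.ad
  · simpa only [map_mul, map_add, map_smul, map_sub, map_pow, hg, div_eq_mul_inv] using hπ HRel.ac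
  · have h1 : Set.range (gen 𝕜 m n ξ) ⊆
        {gen 𝕜 m n ξ 0, gen 𝕜 m n ξ 1, gen 𝕜 m n ξ 2, gen 𝕜 m n ξ 3} := by
      rintro _ ⟨i, rfl⟩
      fin_cases i <;> simp
    have h2 : Set.range (gen 𝕜 m n ξ) = π '' Set.range (FreeAlgebra.ι 𝕜) := by
      rw [← Set.range_comp]
      rfl
    refine top_le_iff.1 (le_trans ?_ (Algebra.adjoin_mono h1))
    rw [h2, ← AlgHom.map_adjoin, FreeAlgebra.adjoin_range_ι, Algebra.map_top]
    exact ((AlgHom.range_eq_top π).2 (RingQuot.mkAlgHom_surjective 𝕜 _)).ge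

variable {𝕜 : Type} [Field 𝕜] {m n : ℕ} {ξ : 𝕜} {W : Type} [AddCommGroup W]
  [Module (H 𝕜 m n ξ) W]

theorem isSemisimpleModule_socle : IsSemisimpleModule (H 𝕜 m n ξ) (socle 𝕜 m n ξ W) := by
  have := isSemisimpleModule_biSup_of_isSemisimpleModule_submodule
    (s := {N : Submodule (H 𝕜 m n ξ) W | IsSimpleModule (H 𝕜 m n ξ) N}) (p := id)
    fun N hN => by
      have : IsSimpleModule (H 𝕜 m n ξ) N := hN
      exact inferInstanceAs (IsSemisimpleModule (H 𝕜 m n ξ) N)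
  rw [socle, sSup_eq_iSup]
  exact this

theorem le_socle (N : Submodule (H 𝕜 m n ξ) W) [IsSemisimpleModule (H 𝕜 m n ξ) N] :
    N ≤ socle 𝕜 m n ξ W := by
  have h := congrArg (Submodule.map N.subtype)
    (IsSemisimpleModule.sSup_simples_eq_top (H 𝕜 m n ξ) N)
  rw [Submodule.map_top, Submodule.range_subtype, sSup_eq_iSup, Submodule.map_iSup] at h
  rw [← h]
  refine iSup_le fun T => ?_
  rw [Submodule.map_iSup]
  refine iSup_le fun hT => le_sSup ?_
  have : IsSimpleModule (H 𝕜 m n ξ) T := hT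
  exact IsSimpleModule.congr (Submodule.equivMapOfInjective _ N.subtype_injective T).symm

end Presentation

/-- Lemma 4.3(1)-(3): if `M` is a finite dimensional indecomposable
`H_{mn}(ξ)`-module of `(s,t)`-type, then `s ≤ 2t`, `t ≤ 2s`, and moreover `t < 2s` when
`s ≠ 1` and `s < 2t` when `t ≠ 1`. -/
theorem statement13 (𝕜 : Type) [Field 𝕜] [IsAlgClosed 𝕜] (m n : ℕ) (hm : 1 < m) (hn : 1 < n)
    (ξ : 𝕜) (hξ : IsPrimitiveRoot ξ (m * n))
    (M : Type) [AddCommGroup M] [Module 𝕜 M] [Module (H 𝕜 m n ξ) M]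
    [IsScalarTower 𝕜 (H 𝕜 m n ξ) M] [FiniteDimensional 𝕜 M]
    (hindec : Indec 𝕜 m n ξ M) (s t : ℕ) (hst : IsType 𝕜 m n ξ M s t) :
    s ≤ 2 * t ∧ t ≤ 2 * s ∧ (s ≠ 1 → t < 2 * s) ∧ (t ≠ 1 → s < 2 * t) := by
  have h_d := doubleRel_gen hm hn hξ
  have hg := h_d.gradedRel
  have := hg.finite
  have : IsArtinianRing (H 𝕜 m n ξ) := isArtinian_of_tower 𝕜 inferInstance
  have : IsSemiprimaryRing (H 𝕜 m n ξ) := inferInstance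
  have hJ : jrad 𝕜 m n ξ = Ring.jacobson (H 𝕜 m n ξ) := Ideal.jacobson_bot
  obtain ⟨⟨hrad, hrad2⟩, ⟨c₁, hc₁, hc₁', ht⟩, ⟨c₂, hc₂, hc₂', hs⟩⟩ := hst
  have hrad_ss : IsSemisimpleModule (H 𝕜 m n ξ) (radM 𝕜 m n ξ M) := by
    refine isSemisimpleModule_of_jacobson_smul fun r hr x => Subtype.ext ?_
    rw [← hJ] at hr
    change r • (x : M) = 0
    have hx : (x : M) ∈ radM 𝕜 m n ξ M := x.2
    suffices ∀ y ∈ radM 𝕜 m n ξ M, ∀ r ∈ jrad 𝕜 m n ξ, r • y = 0 from this _ hx _ hr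
    intro y hy
    induction hy using Submodule.span_induction with
    | mem y hy =>
      obtain ⟨u, hu, w, rfl⟩ := hy
      intro r hr
      have : r • u • w ∈ rad2M 𝕜 m n ξ M := Submodule.subset_span ⟨r, hr, u, hu, w, rfl⟩
      rwa [hrad2, Submodule.mem_bot] at this
    | zero => exact fun r _ => smul_zero r
    | add y z _ _ hy hz => exact fun r hr => by rw [smul_add, hy r hr, hz r hr, add_zero]
    | smul a y _ hy =>
      intro r hr
      rw [← mul_smul]
      refine hy _ ?_
      rw [hJ] at hr ⊢
      exact Ideal.mul_mem_right _ _ hr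
  have hle : radM 𝕜 m n ξ M ≤ socle 𝕜 m n ξ M := le_socle _
  have hss := isSemisimpleModule_socle (𝕜 := 𝕜) (m := m) (n := n) (ξ := ξ) (W := M)
  have hss' : IsSemisimpleModule (H 𝕜 m n ξ) (M ⧸ socle 𝕜 m n ξ M) := by
    refine isSemisimpleModule_of_jacobson_smul fun r hr x => ?_
    obtain ⟨x, rfl⟩ := Submodule.Quotient.mk_surjective _ x
    rw [← Submodule.Quotient.mk_smul, Submodule.Quotient.mk_eq_zero]
    exact hle (Submodule.subset_span ⟨r, hJ ▸ hr, x, rfl⟩)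
  have hbot : socle 𝕜 m n ξ M ≠ ⊥ := fun h => hrad (le_bot_iff.1 (h ▸ hle))
  have htop : socle 𝕜 m n ξ M ≠ ⊤ := by
    intro h
    rw [h] at hss
    refine hrad (le_bot_iff.1 (Submodule.span_le.2 ?_))
    rintro _ ⟨r, hr, w, rfl⟩
    rw [hJ] at hr
    have := Module.mem_annihilator.1
      (IsSemisimpleModule.jacobson_le_annihilator (H 𝕜 m n ξ) (⊤ : Submodule (H 𝕜 m n ξ) M) hr)
      ⟨w, trivial⟩
    exact congrArg Subtype.val this
  obtain ⟨⟨h1, h2⟩, h3, h4⟩ := hg.length_bounds hindec.2 hbot htop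
    (ht ▸ Module.length_compositionSeries c₁ hc₁ hc₁')
    (hs ▸ Module.length_compositionSeries c₂ hc₂ hc₂')
  exact ⟨h3, h1, h2, h4⟩

end Radford
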